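/- arXiv:2208.00687 — 5 statements merged into one kernel-verified Lean document; each statement's English description precedes it below -/
import Mathlib

section
/- Let d ∈ ℕ, α ∈ (0, min(2,d)) and δ ∈ (0, d-α). Then for all t > 0 and x ∈ ℝ^d \ {0}, ∫_{ℝ^d} p̃(t,x,y) h_δ(y) dy ≤ h_δ(x). -/
open MeasureTheory Real Set Filter RealInnerProductSpace

noncomputable section

/-- Euclidean space `ℝ^d`. -/
abbrev Ed (d : ℕ) := EuclideanSpace ℝ (Fin d)

/-- Modified Bessel function of the second kind `K_ν(r)`. -/
def besselK (ν r : ℝ) : ℝ :=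
  (1 / 2) * (r / 2) ^ ν * ∫ u in Ioi (0 : ℝ), u ^ (-ν - 1) * Real.exp (-u - r ^ 2 / (4 * u))

/-- Relativistic `α`-stable heat kernel with mass parameter `m`:
`p^m(t,x,y) = (2π)^{-d} ∫ exp(-i⟨y-x,z⟩) exp(-t(|z|²+m^{2/α})^{α/2}) dz`
(the integral is real, and equals the cosine integral below). -/
def relKernel (d : ℕ) (α m t : ℝ) (x y : Ed d) : ℝ :=
  (2 * π) ^ (-(d : ℝ)) *
    ∫ z : Ed d, Real.cos ⟪y - x, z⟫ * Real.exp (-t * (‖z‖ ^ 2 + m ^ (2 / α)) ^ (α / 2))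

/-- Fractional (`α`-stable) heat kernel `p⁰(t,x,y)`. -/
def fracKernel (d : ℕ) (α t : ℝ) (x y : Ed d) : ℝ :=
  (2 * π) ^ (-(d : ℝ)) * ∫ z : Ed d, Real.cos ⟪y - x, z⟫ * Real.exp (-t * ‖z‖ ^ α)

/-- The summands of the perturbation series. -/
def pertN (d : ℕ) (k : ℝ → Ed d → Ed d → ℝ) (q : Ed d → ℝ) : ℕ → ℝ → Ed d → Ed d → ℝ
  | 0 => k
  | n + 1 => fun t x y =>
      ∫ s in Ioo (0 : ℝ) t, ∫ z : Ed d, pertN d k q n s x z * q z * k (t - s) z y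

/-- Schrödinger perturbation of a transition density `k` by a potential `q`. -/
def pert (d : ℕ) (k : ℝ → Ed d → Ed d → ℝ) (q : Ed d → ℝ) (t : ℝ) (x y : Ed d) : ℝ :=
  ∑' n : ℕ, pertN d k q n t x y

/-- Radial profile of the potential `V_β`. -/
def VProf (d : ℕ) (α β r : ℝ) : ℝ :=
  2 ^ (α / 2) * Real.Gamma (((d : ℝ) - β) / 2) / Real.Gamma (((d : ℝ) - β - α) / 2) *
    (besselK ((β + α) / 2) r / besselK (β / 2) r) * r ^ (-(α / 2))

/-- The potential `V_β(x)`. -/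
def Vbeta (d : ℕ) (α β : ℝ) (x : Ed d) : ℝ := VProf d α β ‖x‖

/-- The Hardy constant `κ_β` for the fractional Laplacian. -/
def kappa (d : ℕ) (α β : ℝ) : ℝ :=
  2 ^ α * Real.Gamma ((β + α) / 2) * Real.Gamma (((d : ℝ) - β) / 2) /
    (Real.Gamma (β / 2) * Real.Gamma (((d : ℝ) - β - α) / 2))

/-- `h^m_β(x) = ∫_0^∞ t^{(d-α-β)/α} p^m(t,x,0) dt`. -/
def hBetaM (d : ℕ) (α m β : ℝ) (x : Ed d) : ℝ :=
  ∫ t in Ioi (0 : ℝ), t ^ (((d : ℝ) - α - β) / α) * relKernel d α m t x 0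

/-- `h_β = h^1_β`. -/
def hBeta (d : ℕ) (α β : ℝ) (x : Ed d) : ℝ := hBetaM d α 1 β x

/-- `V^m_β(x) = ((d-α-β)/α) h^m_{β+α}(x)/h^m_β(x)`. -/
def VbetaM (d : ℕ) (α m β : ℝ) (x : Ed d) : ℝ :=
  (((d : ℝ) - α - β) / α) * hBetaM d α m (β + α) x / hBetaM d α m β x

/-- The function `H⁰(t,x)`. -/
def Hzero (d : ℕ) (α δ t : ℝ) (x : Ed d) : ℝ :=
  if δ ≤ ((d : ℝ) - α) / 2 then 1 + t ^ (δ / α) * ‖x‖ ^ (-δ)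
  else 1 + t ^ (((d : ℝ) - α - δ) / α) * ‖x‖ ^ (-((d : ℝ) - α - δ))

/-- Density of the Lévy measure of the relativistic `α`-stable operator (mass 1). -/
def levyNu (d : ℕ) (α : ℝ) (x : Ed d) : ℝ :=
  2 ^ ((α - (d : ℝ)) / 2 + 1) * π ^ (-(d : ℝ) / 2) * |Real.Gamma (-α / 2)|⁻¹ *
    besselK (((d : ℝ) + α) / 2) ‖x‖ / ‖x‖ ^ (((d : ℝ) + α) / 2)

/-- Sequential closure of the cone generated by decaying exponentials, on `[1,∞)`. -/
inductive CMl : (ℝ → ℝ) → Prop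
  | ex (s : ℝ) (hs : 0 ≤ s) : CMl (fun l => Real.exp (-s * l))
  | add (F G : ℝ → ℝ) (hF : CMl F) (hG : CMl G) : CMl (fun l => F l + G l)
  | smul (c : ℝ) (hc : 0 ≤ c) (F : ℝ → ℝ) (hF : CMl F) : CMl (fun l => c * F l)
  | lim (F : ℕ → ℝ → ℝ) (G : ℝ → ℝ) (hF : ∀ n, CMl (F n))
      (h : ∀ l, 1 ≤ l → Tendsto (fun n => F n l) atTop (nhds (G l))) : CMl G

theorem CMl.congr {F G : ℝ → ℝ} (hF : CMl F) (h : ∀ l, 1 ≤ l → F l = G l) : CMl G :=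
  CMl.lim (fun _ => F) G (fun _ => hF) (fun l hl => by rw [h l hl]; exact tendsto_const_nhds)

theorem CMl.mul {F G : ℝ → ℝ} (hF : CMl F) (hG : CMl G) : CMl (fun l => F l * G l) := by
  induction hF with
  | ex s hs =>
    induction hG with
    | ex s' hs' =>
      refine (CMl.ex (s + s') (by positivity)).congr fun l _ => ?_
      rw [← Real.exp_add]; ring_nf
    | add F G _ _ h1 h2 => exact (CMl.add _ _ h1 h2).congr fun l _ => by ring
    | smul c hc F _ h => exact (CMl.smul c hc _ h).congr fun l _ => by ring
    | lim F G _ h ih => exact CMl.lim _ _ ih fun l hl => (h l hl).const_mul _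
  | add F G _ _ h1 h2 => exact (CMl.add _ _ h1 h2).congr fun l _ => by ring
  | smul c hc F _ h => exact (CMl.smul c hc _ h).congr fun l _ => by ring
  | lim F G _ h ih => exact CMl.lim _ _ ih fun l hl => (h l hl).mul_const _

theorem CMl.const (c : ℝ) (hc : 0 ≤ c) : CMl (fun _ => c) :=
  (CMl.smul c hc _ (CMl.ex 0 le_rfl)).congr fun l _ => by simp

theorem CMl.pow {F : ℝ → ℝ} (hF : CMl F) (n : ℕ) : CMl (fun l => F l ^ n) := by
  induction n with
  | zero => simpa using CMl.const 1 zero_le_one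
  | succ n ih => exact (ih.mul hF).congr fun l _ => by ring

theorem CMl.sum {F : ℕ → ℝ → ℝ} (hF : ∀ n, CMl (F n)) (n : ℕ) :
    CMl (fun l => ∑ i ∈ Finset.range n, F i l) := by
  induction n with
  | zero => simpa using CMl.const 0 le_rfl
  | succ n ih => exact (CMl.add _ _ ih (hF n)).congr fun l _ => by rw [Finset.sum_range_succ]

theorem CMl.hasSum {F : ℕ → ℝ → ℝ} {G : ℝ → ℝ} (hF : ∀ n, CMl (F n))
    (h : ∀ l, 1 ≤ l → HasSum (fun n => F n l) (G l)) : CMl G :=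
  CMl.lim _ _ (fun n => CMl.sum hF n) fun l hl => (h l hl).tendsto_sum_nat

theorem CMl.rexp {F : ℝ → ℝ} (hF : CMl F) : CMl (fun l => Real.exp (F l)) := by
  refine CMl.hasSum (F := fun n l => ((n.factorial : ℝ))⁻¹ * F l ^ n)
    (fun n => CMl.smul _ (by positivity) _ (hF.pow n)) fun l _ => ?_
  have := NormedSpace.expSeries_div_hasSum_exp (F l)
  rw [← Real.exp_eq_exp_ℝ] at this
  simpa [div_eq_inv_mul] using this

theorem CMl.nonneg {F : ℝ → ℝ} (hF : CMl F) : ∀ l, 1 ≤ l → 0 ≤ F l := by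
  induction hF with
  | ex s hs => intro l _; positivity
  | add F G _ _ h1 h2 => intro l hl; exact add_nonneg (h1 l hl) (h2 l hl)
  | smul c hc F _ h => intro l hl; exact mul_nonneg hc (h l hl)
  | lim F G _ h ih => intro l hl; exact ge_of_tendsto' (h l hl) fun n => ih n l hl

theorem CMl.le_one {F : ℝ → ℝ} (hF : CMl F) : ∀ l, 1 ≤ l → F l ≤ F 1 := by
  induction hF with
  | ex s hs => intro l hl; apply Real.exp_le_exp.2; nlinarith
  | add F G _ _ h1 h2 => intro l hl; exact add_le_add (h1 l hl) (h2 l hl)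
  | smul c hc F _ h => intro l hl; exact mul_le_mul_of_nonneg_left (h l hl) hc
  | lim F G _ h ih => intro l hl; exact le_of_tendsto_of_tendsto' (h l hl) (h 1 le_rfl) fun n => ih n l hl

theorem CMl.meas {F : ℝ → ℝ} (hF : CMl F) : Measurable (fun l => F (max 1 l)) := by
  induction hF with
  | ex s hs => fun_prop
  | add F G _ _ h1 h2 => exact h1.add h2
  | smul c hc F _ h => exact h.const_mul c
  | lim F G _ h ih => 
    exact measurable_of_tendsto_metrizable ih (tendsto_pi_nhds.2 fun l => h _ (le_max_left _ _))

theorem choose_succ_real (a : ℝ) (n : ℕ) :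
    Ring.choose a (n + 1) = Ring.choose a n * ((a - n) / (n + 1)) := by
  rw [Ring.choose_eq_smul, Ring.choose_eq_smul, descPochhammer_succ_right, Polynomial.smeval_mul]
  have : (Polynomial.X - (n : Polynomial ℤ)).smeval a = a - n := by
    rw [Polynomial.smeval_sub]; simp [Polynomial.smeval_X, Polynomial.smeval_natCast]
  rw [this, Nat.factorial_succ]
  push_cast
  have : (n.factorial : ℝ) ≠ 0 := by positivity
  simp only [smul_eq_mul]
  field_simp

theorem coef_nonneg (a : ℝ) (ha : 0 < a) (ha1 : a < 1) (n : ℕ) :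
    0 ≤ -((-1) ^ (n + 1) * Ring.choose a (n + 1)) := by
  induction n with
  | zero => simp [ha.le]
  | succ n ih =>
    rw [choose_succ_real]
    have : -((-1 : ℝ) ^ (n + 1 + 1) * (Ring.choose a (n + 1) * ((a - ↑(n + 1)) / (↑(n + 1) + 1))))
       = -((-1) ^ (n + 1) * Ring.choose a (n + 1)) * ((↑(n + 1) - a) / (↑(n + 1) + 1)) := by
      field_simp; ring
    rw [this]
    refine mul_nonneg ih (div_nonneg ?_ (by positivity))
    push_cast
    have : (0:ℝ) ≤ n := by positivity
    linarith

theorem hasSum_binom (a : ℝ) (x : ℝ) (hx : |x| < 1) :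
    HasSum (fun n : ℕ => -((-1) ^ (n + 1) * Ring.choose a (n + 1)) * x ^ (n + 1)) (1 - (1 - x) ^ a) := by
  have h := (Real.one_add_rpow_hasFPowerSeriesOnBall_zero (a := a)).hasSum
    (y := -x) (by simpa [Metric.eball, edist_dist, Real.dist_eq] using hx)
  have h2 : HasSum (fun n : ℕ => (-1) ^ n * Ring.choose a n * x ^ n) ((1 - x) ^ a) := by
    convert! h using 1
    · funext n; simp only [binomialSeries_apply]; simp [neg_pow x]; ring
    · ring_nf
  have h3 := ((hasSum_nat_add_iff' 1).2 h2).neg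
  convert! h3 using 1
  · funext n; ring
  · simp

theorem CMl.rel (a t : ℝ) (ha : 0 < a) (ha1 : a < 1) (ht : 0 ≤ t) :
    CMl (fun l => Real.exp (-t * l ^ a)) := by
  have key : ∀ n : ℕ, CMl (fun l => Real.exp (-t * ((n + 1) * (1 - Real.exp (-l / (n + 1)))) ^ a)) := by
    intro n
    have h1 : CMl (fun l => 1 - (1 - Real.exp (-l / (n + 1))) ^ a) := by
      refine CMl.hasSum (F := fun k l => -((-1) ^ (k + 1) * Ring.choose a (k + 1)) *
        Real.exp (-l / (n + 1)) ^ (k + 1)) (fun k => CMl.smul _ (coef_nonneg a ha ha1 k) _ ?_) ?_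
      · refine CMl.pow ((CMl.ex (1 / (n + 1)) (by positivity)).congr fun l _ => ?_) _
        congr 1; ring
      · intro l hl
        apply hasSum_binom
        rw [abs_of_pos (Real.exp_pos _), Real.exp_lt_one_iff]
        apply div_neg_of_neg_of_pos (by linarith) (by positivity)
    have h2 := (CMl.smul (t * (n + 1) ^ a) (by positivity) _ h1).rexp
    refine (CMl.smul (Real.exp (-(t * (n + 1) ^ a))) (by positivity) _ h2).congr fun l hl => ?_
    rw [← Real.exp_add, Real.mul_rpow (by positivity)]
    · ring_nf
    · have : Real.exp (-l / (n + 1)) ≤ 1 := by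
        rw [Real.exp_le_one_iff]
        exact div_nonpos_of_nonpos_of_nonneg (by linarith) (by positivity)
      linarith
  refine CMl.lim _ _ key fun l hl => ?_
  refine (Real.continuous_exp.tendsto _).comp (Tendsto.const_mul _ ?_)
  refine Tendsto.rpow_const ?_ (Or.inr ha.le)
  -- derivative of 1 - exp(-l u) at 0
  have hd : HasDerivAt (fun u : ℝ => 1 - Real.exp (-l * u)) l 0 := by
    have := ((hasDerivAt_id (0:ℝ)).const_mul (-l)).exp.const_sub 1
    simpa using this
  have := hd.tendsto_slope_zero_right
  have h2 := this.comp (tendsto_nhdsWithin_iff.2 ⟨tendsto_one_div_add_atTop_nhds_zero_nat (𝕜 := ℝ),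
    Eventually.of_forall fun n => by simp only [Set.mem_Ioi]; positivity⟩)
  refine h2.congr fun n => ?_
  simp; left; ring_nf

/-- Gaussian kernel. -/
def gk (d : ℕ) (s : ℝ) (w : Ed d) : ℝ :=
  (4 * π * s) ^ (-((d : ℝ) / 2)) * Real.exp (-(‖w‖ ^ 2 / (4 * s)))

theorem gk_pos (d : ℕ) (s : ℝ) (hs : 0 < s) (w : Ed d) : 0 < gk d s w := by
  unfold gk; positivity

theorem gauss_int (d : ℕ) (b c : ℝ) (hb : 0 < b) (w : Ed d) :
    Integrable (fun v : Ed d => Real.exp (-b * ‖v‖ ^ 2 + c * ⟪w, v⟫)) ∧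
    ∫ v : Ed d, Real.exp (-b * ‖v‖ ^ 2 + c * ⟪w, v⟫) =
      (π / b) ^ ((d : ℝ) / 2) * Real.exp (c ^ 2 * ‖w‖ ^ 2 / (4 * b)) := by
  have h1 := GaussianFourier.integrable_cexp_neg_mul_sq_norm_add (b := (b : ℂ)) (by simpa using hb) (c : ℂ) w
  have h2 := GaussianFourier.integral_cexp_neg_mul_sq_norm_add (b := (b : ℂ)) (by simpa using hb) (c : ℂ) w
  have e : ∀ v : Ed d, Complex.exp (-(b:ℂ) * ‖v‖ ^ 2 + c * (⟪w, v⟫ : ℝ)) =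
      ((Real.exp (-b * ‖v‖ ^ 2 + c * ⟪w, v⟫) : ℝ) : ℂ) := by
    intro v; push_cast; rfl
  constructor
  · have := h1.re
    refine this.congr (ae_of_all _ fun v => ?_)
    simp only [e]; simp only [RCLike.re_to_complex, Complex.ofReal_re]
  · simp only [e] at h2
    rw [integral_complex_ofReal] at h2
    apply Complex.ofReal_injective
    rw [h2]
    push_cast
    rw [Complex.ofReal_cpow (by positivity)]
    simp

theorem gauss_cos (d : ℕ) (s : ℝ) (hs : 0 < s) (w : Ed d) :
    (2 * π) ^ (-(d : ℝ)) * ∫ z : Ed d, Real.cos ⟪w, z⟫ * Real.exp (-s * (‖z‖ ^ 2 + 1)) =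
      Real.exp (-s) * gk d s w := by
  have h1 := GaussianFourier.integrable_cexp_neg_mul_sq_norm_add (b := (s : ℂ)) (by simpa using hs) Complex.I w
  have h2 := GaussianFourier.integral_cexp_neg_mul_sq_norm_add (b := (s : ℂ)) (by simpa using hs) Complex.I w
  have h3 : ∫ z : Ed d, Real.cos ⟪w, z⟫ * Real.exp (-s * (‖z‖ ^ 2 + 1)) =
      Real.exp (-s) * ((π / s) ^ ((d : ℝ) / 2) * Real.exp (-(‖w‖ ^ 2 / (4 * s)))) := by
    have h4 := congrArg Complex.re h2
    have h5 := integral_re h1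
    simp only [RCLike.re_to_complex] at h5
    rw [← h5] at h4
    have e1 : ∀ z : Ed d, (Complex.exp (-(s:ℂ) * ‖z‖ ^ 2 + Complex.I * (⟪w, z⟫ : ℝ))).re =
        Real.cos ⟪w, z⟫ * Real.exp (-s * ‖z‖ ^ 2) := by
      intro z
      rw [Complex.exp_re]
      have : (-(s:ℂ) * ‖z‖ ^ 2 + Complex.I * (⟪w, z⟫ : ℝ)) =
        ((-s * ‖z‖ ^ 2 : ℝ) : ℂ) + (⟪w, z⟫ : ℝ) * Complex.I := by push_cast; ring
      rw [this]
      simp only [Complex.add_re, Complex.add_im, Complex.ofReal_re, Complex.ofReal_im, Complex.re_ofReal_mul, Complex.im_ofReal_mul, Complex.I_re, Complex.I_im]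
      rw [mul_comm]; congr 2 <;> ring
    have e2 : ((↑π / (s:ℂ)) ^ ((Module.finrank ℝ (Ed d) : ℂ) / 2) * Complex.exp (Complex.I ^ 2 * ‖w‖ ^ 2 / (4 * s))) =
       (((π / s) ^ ((d : ℝ) / 2) * Real.exp (-(‖w‖ ^ 2 / (4 * s))) : ℝ) : ℂ) := by
      push_cast
      rw [Complex.ofReal_cpow (by positivity)]
      simp [Complex.I_sq, neg_div]
    rw [e2, Complex.ofReal_re] at h4
    rw [← h4, ← integral_const_mul]
    congr 1; funext z
    rw [e1, mul_left_comm, ← Real.exp_add]; ring_nf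
  rw [h3, gk, mul_left_comm]
  congr 1
  rw [← mul_assoc]
  congr 1
  have e : (2 * π) ^ (-(d : ℝ)) = ((2 * π) ^ 2) ^ (-((d : ℝ) / 2)) := by
    rw [← Real.rpow_natCast, ← Real.rpow_mul (by positivity)]; congr 1; push_cast; ring
  rw [e, Real.rpow_neg (by positivity), Real.rpow_neg (by positivity), ← Real.inv_rpow (by positivity),
    ← Real.inv_rpow (by positivity), ← Real.mul_rpow (by positivity) (by positivity)]
  congr 1
  field_simp; ring

theorem gauss_conv (d : ℕ) (s t : ℝ) (hs : 0 < s) (ht : 0 < t) (w : Ed d) :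
    ∫⁻ z, ENNReal.ofReal (gk d s z) * ENNReal.ofReal (gk d t (w - z)) = ENNReal.ofReal (gk d (s + t) w) := by
  set b := (s + t) / (4 * s * t) with hb
  set c := 1 / (2 * t) with hc
  obtain ⟨hi, hv⟩ := gauss_int d b c (by positivity) w
  set C := (4 * π * s) ^ (-((d : ℝ) / 2)) * (4 * π * t) ^ (-((d : ℝ) / 2)) * Real.exp (-(‖w‖ ^ 2 / (4 * t))) with hC
  have e : ∀ z, gk d s z * gk d t (w - z) = C * Real.exp (-b * ‖z‖ ^ 2 + c * ⟪w, z⟫) := by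
    intro z
    have h : Real.exp (-(‖z‖ ^ 2 / (4 * s))) * Real.exp (-(‖w - z‖ ^ 2 / (4 * t))) =
       Real.exp (-(‖w‖ ^ 2 / (4 * t))) * Real.exp (-b * ‖z‖ ^ 2 + c * ⟪w, z⟫) := by
      rw [← Real.exp_add, ← Real.exp_add, norm_sub_sq_real]
      congr 1
      rw [hb, hc]; field_simp; ring
    unfold gk
    rw [hC]
    linear_combination ((4 * π * s) ^ (-((d : ℝ) / 2)) * (4 * π * t) ^ (-((d : ℝ) / 2))) * h
  have e2 : ∀ z, ENNReal.ofReal (gk d s z) * ENNReal.ofReal (gk d t (w - z)) =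
      ENNReal.ofReal (C * Real.exp (-b * ‖z‖ ^ 2 + c * ⟪w, z⟫)) := by
    intro z
    rw [← ENNReal.ofReal_mul (gk_pos d s hs z).le, e]
  simp_rw [e2]
  rw [← ofReal_integral_eq_lintegral_ofReal (hi.const_mul C) (ae_of_all _ fun z => by positivity),
    integral_const_mul, hv]
  congr 1
  unfold gk
  rw [hC]
  have h1 : (4 * π * s) ^ (-((d : ℝ) / 2)) * (4 * π * t) ^ (-((d : ℝ) / 2)) * (π / b) ^ ((d : ℝ) / 2) =
     (4 * π * (s + t)) ^ (-((d : ℝ) / 2)) := by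
    rw [Real.rpow_neg (by positivity), Real.rpow_neg (by positivity), Real.rpow_neg (by positivity),
      ← Real.inv_rpow (by positivity), ← Real.inv_rpow (by positivity), ← Real.inv_rpow (by positivity),
      ← Real.mul_rpow (by positivity) (by positivity), ← Real.mul_rpow (by positivity) (by positivity)]
    congr 1
    rw [hb]; field_simp
  have h2 : Real.exp (-(‖w‖ ^ 2 / (4 * t))) * Real.exp (c ^ 2 * ‖w‖ ^ 2 / (4 * b)) = Real.exp (-(‖w‖ ^ 2 / (4 * (s + t)))) := by
    rw [← Real.exp_add]; congr 1; rw [hb, hc]; field_simp; ring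
  rw [← h1, ← h2]; ring

/-- Bound for the Gaussian kernel away from the origin. -/
theorem gk_bdd (d : ℕ) (w : Ed d) (hw : w ≠ 0) : ∃ C, 0 ≤ C ∧ ∀ s, 0 < s → gk d s w ≤ C := by
  have hr : 0 < ‖w‖ ^ 2 := by positivity
  refine ⟨(π * ‖w‖ ^ 2) ^ (-((d : ℝ) / 2)) * (d.factorial), by positivity, fun s hs => ?_⟩
  set y := ‖w‖ ^ 2 / (4 * s) with hy
  have hy0 : 0 < y := by positivity
  have e : 4 * π * s = (π * ‖w‖ ^ 2) * y⁻¹ := by rw [hy]; field_simp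
  unfold gk
  rw [e, Real.mul_rpow (by positivity) (by positivity), mul_assoc, ← hy]
  refine mul_le_mul_of_nonneg_left ?_ (by positivity)
  rw [Real.inv_rpow hy0.le, Real.rpow_neg hy0.le, inv_inv, Real.exp_neg, ← div_eq_mul_inv,
    div_le_iff₀ (Real.exp_pos _)]
  rcases le_total y 1 with h | h
  · calc y ^ ((d : ℝ) / 2) ≤ 1 := Real.rpow_le_one hy0.le h (by positivity)
      _ = 1 * 1 := by ring
      _ ≤ _ := mul_le_mul (by exact_mod_cast Nat.one_le_iff_ne_zero.2 (Nat.factorial_ne_zero d)) (Real.one_le_exp hy0.le) zero_le_one (by positivity)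
  · calc y ^ ((d : ℝ) / 2) ≤ y ^ (d : ℝ) := Real.rpow_le_rpow_of_exponent_le h (by
          have : (0:ℝ) ≤ d := by positivity
          linarith)
      _ = y ^ d := Real.rpow_natCast _ _
      _ ≤ _ := by
        have := Real.pow_div_factorial_le_exp y hy0.le d
        rw [div_le_iff₀ (by positivity)] at this
        linarith

/-- Regularised inverse Fourier transform. -/
def II (d : ℕ) (η : ℝ) (F : ℝ → ℝ) (w : Ed d) : ℝ :=
  (2 * π) ^ (-(d : ℝ)) * ∫ z : Ed d, Real.cos ⟪w, z⟫ * (Real.exp (-η * (‖z‖ ^ 2 + 1)) * F (‖z‖ ^ 2 + 1))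

theorem one_le_lam {d : ℕ} (z : Ed d) : 1 ≤ ‖z‖ ^ 2 + 1 := by
  have := sq_nonneg ‖z‖; linarith

theorem CMl.measz {F : ℝ → ℝ} (hF : CMl F) (d : ℕ) : Measurable (fun z : Ed d => F (‖z‖ ^ 2 + 1)) := by
  have : (fun z : Ed d => F (‖z‖ ^ 2 + 1)) = (fun l => F (max 1 l)) ∘ (fun z : Ed d => ‖z‖ ^ 2 + 1) := by
    funext z; simp only [Function.comp]; rw [max_eq_right (one_le_lam z)]
  rw [this]
  exact hF.meas.comp (by fun_prop)

theorem exp_lam_int (d : ℕ) (η : ℝ) (hη : 0 < η) :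
    Integrable (fun z : Ed d => Real.exp (-η * (‖z‖ ^ 2 + 1))) := by
  have := ((gauss_int d η 0 hη 0).1).const_mul (Real.exp (-η))
  refine this.congr (ae_of_all _ fun z => ?_)
  simp only
  rw [← Real.exp_add]; congr 1; simp; ring

theorem cos_bound {d : ℕ} (w z : Ed d) (y B : ℝ) (hy : 0 ≤ y) (hB : y ≤ B) :
    ‖Real.cos ⟪w, z⟫ * y‖ ≤ B := by
  rw [norm_mul, Real.norm_eq_abs, Real.norm_eq_abs, abs_of_nonneg hy]
  calc _ ≤ 1 * y := mul_le_mul_of_nonneg_right (Real.abs_cos_le_one _) hy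
    _ ≤ B := by linarith

theorem II_integ (d : ℕ) (η : ℝ) (hη : 0 < η) {F : ℝ → ℝ} (hF : CMl F) (w : Ed d) :
    Integrable (fun z : Ed d => Real.cos ⟪w, z⟫ * (Real.exp (-η * (‖z‖ ^ 2 + 1)) * F (‖z‖ ^ 2 + 1))) := by
  have := hF.measz d
  have h3 : Measurable (fun z : Ed d => Real.cos ⟪w, z⟫) := Continuous.measurable (by fun_prop)
  refine ((exp_lam_int d η hη).mul_const (F 1)).mono' (h3.mul (Measurable.mul (by fun_prop) this)).aestronglyMeasurable (ae_of_all _ fun z => ?_)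
  have h1 := hF.nonneg _ (one_le_lam z)
  have h2 := hF.le_one _ (one_le_lam z)
  exact cos_bound w z _ _ (by positivity) (mul_le_mul_of_nonneg_left h2 (by positivity))

theorem II_meas (d : ℕ) (η : ℝ) {F : ℝ → ℝ} (hF : CMl F) : Measurable (II d η F) := by
  have := hF.measz d
  unfold II
  refine Measurable.const_mul ?_ _
  have hm : StronglyMeasurable (fun p : Ed d × Ed d =>
    Real.cos ⟪p.1, p.2⟫ * (Real.exp (-η * (‖p.2‖ ^ 2 + 1)) * F (‖p.2‖ ^ 2 + 1))) := by
    apply Measurable.stronglyMeasurable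
    have h2 : Measurable (fun p : Ed d × Ed d => F (‖p.2‖ ^ 2 + 1)) := this.comp measurable_snd
    have h3 : Measurable (fun p : Ed d × Ed d => Real.cos ⟪p.1, p.2⟫) := Continuous.measurable (by fun_prop)
    exact h3.mul (Measurable.mul (by fun_prop) h2)
  exact hm.integral_prod_right'.measurable

theorem II_ex (d : ℕ) (η s : ℝ) (hη : 0 < η) (hs : 0 ≤ s) (w : Ed d) :
    II d η (fun l => Real.exp (-s * l)) w = Real.exp (-(s + η)) * gk d (s + η) w := by
  rw [← gauss_cos d (s + η) (by positivity) w]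
  unfold II
  congr 2; funext z
  rw [← Real.exp_add]; ring_nf

theorem II_add (d : ℕ) (η : ℝ) (hη : 0 < η) {F G : ℝ → ℝ} (hF : CMl F) (hG : CMl G) (w : Ed d) :
    II d η (fun l => F l + G l) w = II d η F w + II d η G w := by
  unfold II
  rw [← mul_add, ← integral_add (II_integ d η hη hF w) (II_integ d η hη hG w)]
  congr 2; funext z; ring

theorem II_smul (d : ℕ) (η c : ℝ) (F : ℝ → ℝ) (w : Ed d) :
    II d η (fun l => c * F l) w = c * II d η F w := by
  unfold II
  rw [mul_left_comm, ← integral_const_mul c]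
  congr 2; funext z; ring

theorem II_congr (d : ℕ) (η : ℝ) {F G : ℝ → ℝ} (h : ∀ l, 1 ≤ l → F l = G l) (w : Ed d) :
    II d η F w = II d η G w := by
  unfold II
  congr 2; funext z; rw [h _ (one_le_lam z)]

theorem II_lim (d : ℕ) (η : ℝ) (hη : 0 < η) {F : ℕ → ℝ → ℝ} {G : ℝ → ℝ} (hF : ∀ n, CMl (F n))
    (h : ∀ l, 1 ≤ l → Tendsto (fun n => F n l) atTop (nhds (G l))) (w : Ed d) :
    Tendsto (fun n => II d η (F n) w) atTop (nhds (II d η G w)) := by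
  unfold II
  refine Tendsto.const_mul _ ?_
  obtain ⟨B, hB⟩ := (h 1 le_rfl).bddAbove_range
  refine tendsto_integral_of_dominated_convergence (fun z => Real.exp (-η * (‖z‖ ^ 2 + 1)) * B)
    (fun n => (II_integ d η hη (hF n) w).aestronglyMeasurable) ((exp_lam_int d η hη).mul_const B)
    (fun n => ae_of_all _ fun z => ?_) (ae_of_all _ fun z => ?_)
  · have h1 := (hF n).nonneg _ (one_le_lam z)
    have h2 := ((hF n).le_one _ (one_le_lam z)).trans (hB ⟨n, rfl⟩)
    exact cos_bound w z _ _ (by positivity) (mul_le_mul_of_nonneg_left h2 (by positivity))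
  · exact ((h _ (one_le_lam z)).const_mul _).const_mul _

theorem II_nonneg (d : ℕ) (η : ℝ) (hη : 0 < η) {F : ℝ → ℝ} (hF : CMl F) (w : Ed d) : 0 ≤ II d η F w := by
  induction hF with
  | ex s hs =>
    rw [II_ex d η s hη hs]; exact mul_nonneg (Real.exp_pos _).le (gk_pos d _ (by positivity) w).le
  | add F G hF hG h1 h2 => rw [II_add d η hη hF hG]; exact add_nonneg h1 h2
  | smul c hc F _ h => rw [II_smul]; exact mul_nonneg hc h
  | lim F G hF h ih => exact ge_of_tendsto' (II_lim d η hη hF h w) ih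

theorem II_le (d : ℕ) (η : ℝ) (hη : 0 < η) {F : ℝ → ℝ} (hF : CMl F) (w : Ed d) (C : ℝ) (hC0 : 0 ≤ C)
    (hC : ∀ s, 0 < s → gk d s w ≤ C) : II d η F w ≤ C * F 1 := by
  induction hF with
  | ex s hs =>
    rw [II_ex d η s hη hs, mul_comm]
    refine mul_le_mul (hC _ (by positivity)) (Real.exp_le_exp.2 (by linarith)) (by positivity) hC0
  | add F G hF hG h1 h2 => rw [II_add d η hη hF hG]; linarith
  | smul c hc F _ h => rw [II_smul]; nlinarith
  | lim F G hF h ih =>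
    exact le_of_tendsto_of_tendsto' (II_lim d η hη hF h w) ((h 1 le_rfl).const_mul C) ih

/-- The sub-Chapman-Kolmogorov property for the regularised kernels. -/
def CKp (d : ℕ) (F G : ℝ → ℝ) : Prop := ∀ η η' : ℝ, 0 < η → 0 < η' → ∀ w : Ed d,
  ∫⁻ z, ENNReal.ofReal (II d η F z) * ENNReal.ofReal (II d η' G (w - z)) ≤
    ENNReal.ofReal (II d (η + η') (fun l => F l * G l) w)

theorem CKp.symm {d : ℕ} {F G : ℝ → ℝ} (h : CKp d F G) : CKp d G F := by
  intro η η' hη hη' w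
  have := h η' η hη' hη w
  rw [← lintegral_sub_left_eq_self _ w] at this
  simp only [sub_sub_cancel] at this
  rw [II_congr d (η + η') (G := fun l => F l * G l) (fun l _ => mul_comm _ _), add_comm η]
  refine le_trans (le_of_eq ?_) this
  congr 1; funext z; rw [mul_comm]

theorem CKp.add {d : ℕ} {F G H : ℝ → ℝ} (hF : CMl F) (hG : CMl G) (hH : CMl H)
    (h1 : CKp d F H) (h2 : CKp d G H) : CKp d (fun l => F l + G l) H := by
  intro η η' hη hη' w
  have hp : 0 < η + η' := by positivity
  rw [II_congr d (η + η') (G := fun l => F l * H l + G l * H l) (fun l _ => by ring),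
    II_add d _ hp (hF.mul hH) (hG.mul hH),
    ENNReal.ofReal_add (II_nonneg d _ hp (hF.mul hH) w) (II_nonneg d _ hp (hG.mul hH) w)]
  refine le_trans (le_of_eq ?_) (add_le_add (h1 η η' hη hη' w) (h2 η η' hη hη' w))
  have m1 := II_meas d η hF
  have m2 := II_meas d η' hH
  rw [← lintegral_add_left (by fun_prop)]
  congr 1; funext z
  rw [II_add d _ hη hF hG, ENNReal.ofReal_add (II_nonneg d _ hη hF z) (II_nonneg d _ hη hG z), add_mul]

theorem CKp.smul {d : ℕ} {F H : ℝ → ℝ} (c : ℝ) (hc : 0 ≤ c) (hF : CMl F) (hH : CMl H)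
    (h1 : CKp d F H) : CKp d (fun l => c * F l) H := by
  intro η η' hη hη' w
  rw [II_congr d (η + η') (G := fun l => c * (F l * H l)) (fun l _ => by ring), II_smul, ENNReal.ofReal_mul hc]
  refine le_trans (le_of_eq ?_) (mul_le_mul_right (h1 η η' hη hη' w) _)
  have m1 := II_meas d η hF
  have m2 := II_meas d η' hH
  rw [← lintegral_const_mul _ (by fun_prop)]
  congr 1; funext z
  rw [II_smul, ENNReal.ofReal_mul hc, mul_assoc]

theorem CKp.lim {d : ℕ} {F : ℕ → ℝ → ℝ} {G H : ℝ → ℝ} (hF : ∀ n, CMl (F n)) (hH : CMl H)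
    (h : ∀ l, 1 ≤ l → Tendsto (fun n => F n l) atTop (nhds (G l)))
    (ih : ∀ n, CKp d (F n) H) : CKp d G H := by
  intro η η' hη hη' w
  have hp : 0 < η + η' := by positivity
  have ht : Tendsto (fun n => ENNReal.ofReal (II d (η + η') (fun l => F n l * H l) w)) atTop
      (nhds (ENNReal.ofReal (II d (η + η') (fun l => G l * H l) w))) :=
    ENNReal.tendsto_ofReal (II_lim d _ hp (fun n => (hF n).mul hH) (fun l hl => (h l hl).mul_const _) w)
  have m1 := fun n => II_meas d η (hF n)
  have m2 := II_meas d η' hH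
  have hl : ∀ z, ENNReal.ofReal (II d η G z) * ENNReal.ofReal (II d η' H (w - z)) =
     liminf (fun n => ENNReal.ofReal (II d η (F n) z) * ENNReal.ofReal (II d η' H (w - z))) atTop := by
    intro z
    refine (Tendsto.liminf_eq ?_).symm
    exact ENNReal.Tendsto.mul_const (ENNReal.tendsto_ofReal (II_lim d η hη hF h z)) (Or.inr ENNReal.ofReal_ne_top)
  simp_rw [hl]
  refine (lintegral_liminf_le fun n => by fun_prop).trans ?_
  rw [← ht.liminf_eq]
  exact liminf_le_liminf (Eventually.of_forall fun n => ih n η η' hη hη' w)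

theorem CKp.base {d : ℕ} (s t : ℝ) (hs : 0 ≤ s) (ht : 0 ≤ t) :
    CKp d (fun l => Real.exp (-s * l)) (fun l => Real.exp (-t * l)) := by
  intro η η' hη hη' w
  rw [II_congr d (η + η') (G := fun l => Real.exp (-(s + t) * l)) (fun l _ => by rw [← Real.exp_add]; ring_nf),
    II_ex d _ _ (by positivity) (by positivity)]
  have : ∀ z, ENNReal.ofReal (II d η (fun l => Real.exp (-s * l)) z) *
      ENNReal.ofReal (II d η' (fun l => Real.exp (-t * l)) (w - z)) =
      ENNReal.ofReal (Real.exp (-(s + η)) * Real.exp (-(t + η'))) *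
      (ENNReal.ofReal (gk d (s + η) z) * ENNReal.ofReal (gk d (t + η') (w - z))) := by
    intro z
    rw [II_ex d _ _ hη hs, II_ex d _ _ hη' ht, ENNReal.ofReal_mul (Real.exp_pos _).le,
      ENNReal.ofReal_mul (Real.exp_pos _).le, ENNReal.ofReal_mul (Real.exp_pos _).le]
    ring
  simp_rw [this]
  rw [lintegral_const_mul' _ _ ENNReal.ofReal_ne_top, gauss_conv d _ _ (by positivity) (by positivity),
    ← ENNReal.ofReal_mul (by positivity), ← Real.exp_add]
  apply le_of_eq
  ring_nf

theorem CKp.all {d : ℕ} {F G : ℝ → ℝ} (hF : CMl F) (hG : CMl G) : CKp d F G := by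
  induction hF with
  | ex s hs =>
    apply CKp.symm
    induction hG with
    | ex t ht => exact CKp.base t s ht hs
    | add F G hF hG h1 h2 => exact CKp.add hF hG (CMl.ex s hs) h1 h2
    | smul c hc F hF h => exact CKp.smul c hc hF (CMl.ex s hs) h
    | lim F G hF h ih => exact CKp.lim hF (CMl.ex s hs) h ih
  | add F G' hF hG' h1 h2 => exact CKp.add hF hG' hG h1 h2
  | smul c hc F hF h => exact CKp.smul c hc hF hG h
  | lim F G' hF h ih => exact CKp.lim hF hG h ih

theorem CMl.rel' (a t : ℝ) (ha : 0 < a) (ha1 : a ≤ 1) (ht : 0 ≤ t) :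
    CMl (fun l => Real.exp (-t * l ^ a)) := by
  rcases ha1.lt_or_eq with h | h
  · exact CMl.rel a t ha h ht
  · subst h; simpa using CMl.ex t ht

theorem int_E (d : ℕ) (a t : ℝ) (ha : 0 < a) (ht : 0 < t) :
    Integrable (fun z : Ed d => Real.exp (-t * (‖z‖ ^ 2 + 1) ^ a)) := by
  obtain ⟨n, hn⟩ := exists_nat_gt ((d : ℝ) / (2 * a))
  have hn' : (d : ℝ) < 2 * a * n := by
    rw [div_lt_iff₀ (by positivity)] at hn; linarith
  have h := integrable_rpow_neg_one_add_norm_sq (E := Ed d) (μ := volume) (r := 2 * a * n) (by simpa using hn')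
  refine (h.const_mul (n.factorial / t ^ n)).mono' (Measurable.aestronglyMeasurable (by fun_prop)) (ae_of_all _ fun z => ?_)
  rw [Real.norm_eq_abs, abs_of_pos (Real.exp_pos _)]
  set L := ‖z‖ ^ 2 + 1 with hL
  have hL1 : 1 ≤ L := one_le_lam z
  have hL0 : 0 < L := by linarith
  have := Real.pow_div_factorial_le_exp (t * L ^ a) (by positivity) n
  rw [add_comm 1 (‖z‖ ^ 2), ← hL, neg_mul, Real.exp_neg]
  have e : L ^ (-(2 * a * n) / 2) = ((L ^ a) ^ n)⁻¹ := by
    rw [← Real.rpow_natCast, ← Real.rpow_mul hL0.le, ← Real.rpow_neg hL0.le]; congr 1; ring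
  rw [e]
  calc _ ≤ ((t * L ^ a) ^ n / n.factorial)⁻¹ := inv_anti₀ (by positivity) this
    _ = _ := by rw [mul_pow]; field_simp

theorem II0_tendsto (d : ℕ) (a t : ℝ) (ha : 0 < a) (ht : 0 < t) (w : Ed d) :
    Tendsto (fun n : ℕ => II d (1 / ((n : ℝ) + 1)) (fun l => Real.exp (-t * l ^ a)) w) atTop
      (nhds (II d 0 (fun l => Real.exp (-t * l ^ a)) w)) := by
  unfold II
  refine Tendsto.const_mul _ ?_
  refine tendsto_integral_of_dominated_convergence (fun z => Real.exp (-t * (‖z‖ ^ 2 + 1) ^ a))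
    (fun n => Measurable.aestronglyMeasurable (by fun_prop)) (int_E d a t ha ht)
    (fun n => ae_of_all _ fun z => ?_) (ae_of_all _ fun z => ?_)
  · refine cos_bound w z _ _ (by positivity) ?_
    refine mul_le_of_le_one_left (by positivity) ?_
    rw [Real.exp_le_one_iff]
    have := one_le_lam z
    have : 0 ≤ 1 / ((n : ℝ) + 1) * (‖z‖ ^ 2 + 1) := by positivity
    linarith
  · refine ((Tendsto.mul_const _ ?_).const_mul _)
    refine (Real.continuous_exp.tendsto _).comp (Tendsto.mul_const _ ?_)
    exact tendsto_one_div_add_atTop_nhds_zero_nat.neg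

/-- The kernel as a function of the difference. -/
def pk (d : ℕ) (a t : ℝ) (w : Ed d) : ℝ := II d 0 (fun l => Real.exp (-t * l ^ a)) w

theorem eta_pos (n : ℕ) : (0 : ℝ) < 1 / ((n : ℝ) + 1) := by positivity

theorem pk_nonneg (d : ℕ) (a t : ℝ) (ha : 0 < a) (ha1 : a ≤ 1) (ht : 0 < t) (w : Ed d) : 0 ≤ pk d a t w :=
  ge_of_tendsto' (II0_tendsto d a t ha ht w) fun n => II_nonneg d _ (eta_pos n) (CMl.rel' a t ha ha1 ht.le) w

theorem pk_CK (d : ℕ) (a s t : ℝ) (ha : 0 < a) (ha1 : a ≤ 1) (hs : 0 < s) (ht : 0 < t) (w : Ed d) :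
    ∫⁻ z, ENNReal.ofReal (pk d a s z) * ENNReal.ofReal (pk d a t (w - z)) ≤ ENNReal.ofReal (pk d a (s + t) w) := by
  have hl : ∀ z, ENNReal.ofReal (pk d a s z) * ENNReal.ofReal (pk d a t (w - z)) =
     liminf (fun n : ℕ => ENNReal.ofReal (II d (1 / ((n : ℝ) + 1)) (fun l => Real.exp (-s * l ^ a)) z) *
        ENNReal.ofReal (II d (1 / ((n : ℝ) + 1)) (fun l => Real.exp (-t * l ^ a)) (w - z))) atTop := by
    intro z
    refine (Tendsto.liminf_eq ?_).symm
    exact ENNReal.Tendsto.mul (ENNReal.tendsto_ofReal (II0_tendsto d a s ha hs z)) (Or.inr ENNReal.ofReal_ne_top)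
      (ENNReal.tendsto_ofReal (II0_tendsto d a t ha ht _)) (Or.inr ENNReal.ofReal_ne_top)
  have c1 := CMl.rel' a s ha ha1 hs.le
  have c2 := CMl.rel' a t ha ha1 ht.le
  have m1 := fun n : ℕ => II_meas d (1 / ((n : ℝ) + 1)) c1
  have m2 := fun n : ℕ => II_meas d (1 / ((n : ℝ) + 1)) c2
  have hT : Tendsto (fun n : ℕ => ENNReal.ofReal (II d (1 / ((n : ℝ) + 1) + 1 / ((n : ℝ) + 1)) (fun l => Real.exp (-(s + t) * l ^ a)) w)) atTop
      (nhds (ENNReal.ofReal (pk d a (s + t) w))) := by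
    apply ENNReal.tendsto_ofReal
    unfold pk II
    refine Tendsto.const_mul _ ?_
    refine tendsto_integral_of_dominated_convergence (fun z => Real.exp (-(s + t) * (‖z‖ ^ 2 + 1) ^ a))
      (fun n => Measurable.aestronglyMeasurable (by fun_prop)) (int_E d a (s + t) ha (by positivity))
      (fun n => ae_of_all _ fun z => ?_) (ae_of_all _ fun z => ?_)
    · refine cos_bound w z _ _ (by positivity) ?_
      refine mul_le_of_le_one_left (by positivity) ?_
      rw [Real.exp_le_one_iff]
      have := one_le_lam z
      have : 0 ≤ (1 / ((n : ℝ) + 1) + 1 / ((n : ℝ) + 1)) * (‖z‖ ^ 2 + 1) := by positivity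
      linarith
    · refine ((Tendsto.mul_const _ ?_).const_mul _)
      refine (Real.continuous_exp.tendsto _).comp (Tendsto.mul_const _ ?_)
      refine Tendsto.neg ?_
      simpa using (tendsto_one_div_add_atTop_nhds_zero_nat (𝕜 := ℝ)).add (tendsto_one_div_add_atTop_nhds_zero_nat (𝕜 := ℝ))
  simp_rw [hl]
  refine (lintegral_liminf_le fun n => ?_).trans ?_
  · have := m1 n
    have := m2 n
    fun_prop
  rw [← hT.liminf_eq]
  refine liminf_le_liminf (Eventually.of_forall fun n => ?_)
  refine (CKp.all c1 c2 _ _ (eta_pos n) (eta_pos n) w).trans (le_of_eq ?_)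
  congr 1
  exact II_congr d _ (fun l _ => by rw [← Real.exp_add]; ring_nf) w

theorem pk_meas (d : ℕ) (a : ℝ) : Measurable (fun q : ℝ × Ed d => pk d a q.1 q.2) := by
  unfold pk II
  refine Measurable.const_mul ?_ _
  have hm : StronglyMeasurable (fun p : (ℝ × Ed d) × Ed d =>
    Real.cos ⟪p.1.2, p.2⟫ * (Real.exp (-0 * (‖p.2‖ ^ 2 + 1)) * Real.exp (-p.1.1 * (‖p.2‖ ^ 2 + 1) ^ a))) := by
    apply Measurable.stronglyMeasurable
    have h3 : Measurable (fun p : (ℝ × Ed d) × Ed d => Real.cos ⟪p.1.2, p.2⟫) := Continuous.measurable (by fun_prop)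
    exact h3.mul (by fun_prop)
  exact hm.integral_prod_right'.measurable

theorem pk_meas_comp (d : ℕ) (a : ℝ) {X : Type*} [MeasurableSpace X] (f : X → ℝ) (g : X → Ed d)
    (hf : Measurable f) (hg : Measurable g) : Measurable (fun x => pk d a (f x) (g x)) := by
  have h : Measurable (fun x => (f x, g x)) := hf.prodMk hg
  have := (pk_meas d a).comp h
  simpa only [Function.comp_def] using this

theorem gamma_int (γ : ℝ) (hγ : 0 < γ) : IntegrableOn (fun t : ℝ => t ^ (γ - 1) * Real.exp (-t)) (Ioi 0) := by
  refine (Real.GammaIntegral_convergent hγ).congr_fun (fun t _ => mul_comm _ _) measurableSet_Ioi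

theorem reg_fubini (d : ℕ) (a γ η : ℝ) (ha : 0 < a) (hγ : 0 < γ) (hη : 0 < η) (w : Ed d) :
    ∫ t in Ioi (0 : ℝ), t ^ (γ - 1) * II d η (fun l => Real.exp (-t * l ^ a)) w =
      Real.Gamma γ * II d η (fun l => (1 / l) ^ (a * γ)) w := by
  rw [← II_smul]
  unfold II
  have e1 : ∀ t : ℝ, t ^ (γ - 1) * ((2 * π) ^ (-(d : ℝ)) * ∫ z : Ed d, Real.cos ⟪w, z⟫ *
      (Real.exp (-η * (‖z‖ ^ 2 + 1)) * Real.exp (-t * (‖z‖ ^ 2 + 1) ^ a))) =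
      (2 * π) ^ (-(d : ℝ)) * ∫ z : Ed d, t ^ (γ - 1) * (Real.cos ⟪w, z⟫ *
      (Real.exp (-η * (‖z‖ ^ 2 + 1)) * Real.exp (-t * (‖z‖ ^ 2 + 1) ^ a))) := by
    intro t
    rw [mul_left_comm, ← integral_const_mul]
  simp_rw [e1]
  rw [integral_const_mul]
  congr 1
  rw [integral_integral_swap]
  · congr 1; funext z
    have h := Real.integral_rpow_mul_exp_neg_mul_Ioi (a := γ) (r := (‖z‖ ^ 2 + 1) ^ a) hγ (by positivity)
    have e : (1 / (‖z‖ ^ 2 + 1) ^ a) ^ γ = (1 / (‖z‖ ^ 2 + 1)) ^ (a * γ) := by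
      rw [Real.rpow_mul (by positivity), Real.div_rpow (x := 1) (y := ‖z‖ ^ 2 + 1) (by positivity) (by positivity), Real.one_rpow]
    rw [e] at h
    rw [mul_comm (Real.Gamma γ), ← h, ← integral_const_mul, ← integral_const_mul]
    congr 1; funext t
    rw [neg_mul t, mul_comm t]; ring
  · have hp := (gamma_int γ hγ).mul_prod (exp_lam_int d η hη)
    refine hp.mono' ?_ ?_
    · apply Measurable.aestronglyMeasurable
      have h3 : Measurable (fun p : ℝ × Ed d => Real.cos ⟪w, p.2⟫) := Continuous.measurable (by fun_prop)
      exact Measurable.mul (by fun_prop) (h3.mul (by fun_prop))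
    · have : ∀ᵐ p : ℝ × Ed d ∂((volume.restrict (Ioi 0)).prod volume), p.1 ∈ Ioi (0 : ℝ) :=
        Measure.quasiMeasurePreserving_fst.ae (ae_restrict_mem measurableSet_Ioi)
      filter_upwards [this] with p hp
      have hp : 0 < p.1 := hp
      simp only [Function.uncurry]
      rw [norm_mul, Real.norm_eq_abs, abs_of_nonneg (by positivity), mul_assoc]
      refine mul_le_mul_of_nonneg_left ?_ (by positivity)
      refine cos_bound _ _ _ _ (by positivity) ?_
      rw [mul_comm]
      refine mul_le_mul_of_nonneg_right (Real.exp_le_exp.2 ?_) (by positivity)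
      have : 1 ≤ (‖p.2‖ ^ 2 + 1) ^ a := Real.one_le_rpow (one_le_lam _) ha.le
      nlinarith

theorem reg_limit (d : ℕ) (a γ : ℝ) (ha : 0 < a) (ha1 : a ≤ 1) (hγ : 0 < γ) (w : Ed d) (hw : w ≠ 0) :
    IntegrableOn (fun t => t ^ (γ - 1) * pk d a t w) (Ioi 0) ∧
    Tendsto (fun n : ℕ => II d (1 / ((n : ℝ) + 1)) (fun l => (1 / l) ^ (a * γ)) w) atTop
      (nhds ((Real.Gamma γ)⁻¹ * ∫ t in Ioi (0 : ℝ), t ^ (γ - 1) * pk d a t w)) := by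
  obtain ⟨C, hC0, hC⟩ := gk_bdd d w hw
  have hb : Integrable (fun t : ℝ => C * (t ^ (γ - 1) * Real.exp (-t))) (volume.restrict (Ioi 0)) :=
    Integrable.const_mul (gamma_int γ hγ) C
  have hbd : ∀ n : ℕ, ∀ t : ℝ, 0 < t → ‖t ^ (γ - 1) * II d (1 / ((n : ℝ) + 1)) (fun l => Real.exp (-t * l ^ a)) w‖ ≤
      C * (t ^ (γ - 1) * Real.exp (-t)) := by
    intro n t ht
    have c := CMl.rel' a t ha ha1 ht.le
    have h1 := II_nonneg d _ (eta_pos n) c w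
    have h2 := II_le d _ (eta_pos n) c w C hC0 hC
    rw [Real.norm_eq_abs, abs_of_nonneg (by positivity), mul_left_comm]
    refine mul_le_mul_of_nonneg_left ?_ (by positivity)
    simpa using h2
  have hpk : ∀ t : ℝ, 0 < t → ‖t ^ (γ - 1) * pk d a t w‖ ≤ C * (t ^ (γ - 1) * Real.exp (-t)) := fun t ht =>
    le_of_tendsto' (((II0_tendsto d a t ha ht w).const_mul (t ^ (γ - 1))).norm) fun n => hbd n t ht
  constructor
  · have hm : Measurable (fun t : ℝ => pk d a t w) :=
      pk_meas_comp d a (fun t => t) (fun _ => w) measurable_id measurable_const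
    have hm2 : Measurable (fun t : ℝ => t ^ (γ - 1) * pk d a t w) := by fun_prop
    have hae : ∀ᵐ t ∂(volume.restrict (Ioi (0:ℝ))), ‖t ^ (γ - 1) * pk d a t w‖ ≤ C * (t ^ (γ - 1) * Real.exp (-t)) :=
      ae_restrict_of_forall_mem measurableSet_Ioi hpk
    exact Integrable.mono' hb hm2.aestronglyMeasurable hae
  · have hT : Tendsto (fun n : ℕ => ∫ t in Ioi (0 : ℝ), t ^ (γ - 1) * II d (1 / ((n : ℝ) + 1)) (fun l => Real.exp (-t * l ^ a)) w) atTop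
        (nhds (∫ t in Ioi (0 : ℝ), t ^ (γ - 1) * pk d a t w)) := by
      refine tendsto_integral_of_dominated_convergence _ (fun n => ?_) hb
        (fun n => ae_restrict_of_forall_mem measurableSet_Ioi (hbd n))
        (ae_restrict_of_forall_mem measurableSet_Ioi fun t ht => (II0_tendsto d a t ha ht w).const_mul _)
      apply Measurable.aestronglyMeasurable
      refine Measurable.mul (by fun_prop) ?_
      unfold II
      refine Measurable.const_mul ?_ _
      have hm : StronglyMeasurable (fun p : ℝ × Ed d =>
        Real.cos ⟪w, p.2⟫ * (Real.exp (-(1 / ((n : ℝ) + 1)) * (‖p.2‖ ^ 2 + 1)) * Real.exp (-p.1 * (‖p.2‖ ^ 2 + 1) ^ a))) := by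
        apply Measurable.stronglyMeasurable
        have h3 : Measurable (fun p : ℝ × Ed d => Real.cos ⟪w, p.2⟫) := Continuous.measurable (by fun_prop)
        exact h3.mul (by fun_prop)
      exact hm.integral_prod_right'.measurable
    have := hT.const_mul (Real.Gamma γ)⁻¹
    refine this.congr fun n => ?_
    rw [reg_fubini d a γ _ ha hγ (eta_pos n), ← mul_assoc, inv_mul_cancel₀ (Real.Gamma_pos_of_pos hγ).ne', one_mul]

theorem pk_one (d : ℕ) (t : ℝ) (ht : 0 < t) (w : Ed d) : pk d 1 t w = Real.exp (-t) * gk d t w := by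
  rw [← gauss_cos d t ht w]
  unfold pk II
  simp

theorem pot_formula (d : ℕ) (a γ : ℝ) (ha : 0 < a) (ha1 : a ≤ 1) (hγ : 0 < γ) (w : Ed d) (hw : w ≠ 0) :
    ∫ t in Ioi (0 : ℝ), t ^ (γ - 1) * pk d a t w =
      Real.Gamma γ / Real.Gamma (a * γ) * ∫ s in Ioi (0 : ℝ), s ^ (a * γ - 1) * (Real.exp (-s) * gk d s w) := by
  have h1 := (reg_limit d a γ ha ha1 hγ w hw).2
  have h2 := (reg_limit d 1 (a * γ) one_pos le_rfl (by positivity) w hw).2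
  rw [one_mul] at h2
  have h3 := tendsto_nhds_unique h1 h2
  have e : ∫ t in Ioi (0 : ℝ), t ^ (a * γ - 1) * pk d 1 t w = ∫ s in Ioi (0 : ℝ), s ^ (a * γ - 1) * (Real.exp (-s) * gk d s w) :=
    setIntegral_congr_fun measurableSet_Ioi fun t ht => by rw [pk_one d t ht]
  rw [e, inv_mul_eq_iff_eq_mul₀ (Real.Gamma_pos_of_pos hγ).ne'] at h3
  rw [h3]; ring

theorem pot_int_pos (d : ℕ) (b : ℝ) (hb : 0 < b) (w : Ed d) (hw : w ≠ 0) :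
    0 < ∫ s in Ioi (0 : ℝ), s ^ (b - 1) * (Real.exp (-s) * gk d s w) := by
  have h1 := (reg_limit d 1 b one_pos le_rfl hb w hw).1
  have h2 : IntegrableOn (fun s => s ^ (b - 1) * (Real.exp (-s) * gk d s w)) (Ioi 0) :=
    h1.congr_fun (fun t ht => by simp only; rw [pk_one d t ht]) measurableSet_Ioi
  refine (integral_pos_iff_support_of_nonneg_ae ?_ h2).2 ?_
  · refine (ae_restrict_iff' measurableSet_Ioi).2 (ae_of_all _ fun s hs => ?_)
    have hs : 0 < s := hs
    have := gk_pos d s hs w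
    simp only [Pi.zero_apply]; positivity
  · refine lt_of_lt_of_le ?_ (measure_mono (s := Ioi 0) fun s hs => ?_)
    · simp
    · have hs : 0 < s := hs
      have := gk_pos d s hs w
      simp only [Function.mem_support]; positivity

open scoped ENNReal

/-- Extended-real version of the summands of the perturbation series, starting point `x` fixed. -/
def PE {E : Type*} [MeasureSpace E] (k : ℝ → E → E → ℝ≥0∞) (q : E → ℝ≥0∞) (x : E) : ℕ → ℝ → E → ℝ≥0∞
  | 0 => fun t y => k t x y
  | n + 1 => fun t y => ∫⁻ s in Ioo (0 : ℝ) t, ∫⁻ z, PE k q x n s z * q z * k (t - s) z y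

theorem k_comp {E : Type*} [MeasurableSpace E] {k : ℝ → E → E → ℝ≥0∞}
    (hk : Measurable (fun p : ℝ × E × E => k p.1 p.2.1 p.2.2)) {X : Type*} [MeasurableSpace X]
    {f : X → ℝ} {g h : X → E} (hf : Measurable f) (hg : Measurable g) (hh : Measurable h) :
    Measurable (fun x => k (f x) (g x) (h x)) := by
  have := hk.comp (hf.prodMk (hg.prodMk hh))
  simpa only [Function.comp_def] using this

theorem P_comp {E : Type*} [MeasurableSpace E] {P : ℝ → E → ℝ≥0∞}
    (hP : Measurable (fun p : ℝ × E => P p.1 p.2)) {X : Type*} [MeasurableSpace X]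
    {f : X → ℝ} {g : X → E} (hf : Measurable f) (hg : Measurable g) :
    Measurable (fun x => P (f x) (g x)) := by
  have := hP.comp (hf.prodMk hg)
  simpa only [Function.comp_def] using this

/-- Integrals over a variable interval are measurable. -/
theorem meas_Ioo {X : Type*} [MeasurableSpace X] (φ : X → ℝ → ℝ≥0∞) (f : X → ℝ) (hf : Measurable f)
    (hφ : Measurable (fun p : X × ℝ => φ p.1 p.2)) :
    Measurable (fun x => ∫⁻ s in Ioo (0 : ℝ) (f x), φ x s) := by
  have e : ∀ x, ∫⁻ s in Ioo (0 : ℝ) (f x), φ x s = ∫⁻ s, (if 0 < s ∧ s < f x then φ x s else 0) := by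
    intro x
    rw [← lintegral_indicator measurableSet_Ioo]
    congr 1; funext s; simp [Set.indicator]
  simp_rw [e]
  apply Measurable.lintegral_prod_right'
    (f := fun p : X × ℝ => if 0 < p.2 ∧ p.2 < f p.1 then φ p.1 p.2 else 0)
  refine Measurable.ite ?_ hφ measurable_const
  exact (measurableSet_lt measurable_const measurable_snd).inter
    (measurableSet_lt measurable_snd (hf.comp measurable_fst))

theorem PE_meas {E : Type*} [MeasureSpace E] [SFinite (volume : Measure E)] {k : ℝ → E → E → ℝ≥0∞}
    {q : E → ℝ≥0∞} (hk : Measurable (fun p : ℝ × E × E => k p.1 p.2.1 p.2.2)) (hq : Measurable q) (x : E) (n : ℕ) :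
    Measurable (fun p : ℝ × E => PE k q x n p.1 p.2) := by
  induction n with
  | zero => exact k_comp hk measurable_fst measurable_const measurable_snd
  | succ n ih =>
    simp only [PE]
    apply meas_Ioo (X := ℝ × E) (fun p s => ∫⁻ z, PE k q x n s z * q z * k (p.1 - s) z p.2) _ measurable_fst
    apply Measurable.lintegral_prod_right'
      (f := fun w : ((ℝ × E) × ℝ) × E => PE k q x n w.1.2 w.2 * q w.2 * k (w.1.1.1 - w.1.2) w.2 w.1.1.2)
    refine ((P_comp ih (by fun_prop) (by fun_prop)).mul (hq.comp measurable_snd)).mul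
      (k_comp hk (by fun_prop) (by fun_prop) (by fun_prop))

theorem triangle_swap (φ : ℝ → ℝ → ℝ≥0∞) (hφ : Measurable (fun p : ℝ × ℝ => φ p.1 p.2)) (t : ℝ) :
    ∫⁻ r in Ioo (0 : ℝ) t, ∫⁻ s in Ioo (0 : ℝ) r, φ s (r - s) =
    ∫⁻ s in Ioo (0 : ℝ) t, ∫⁻ r in Ioo (0 : ℝ) (t - s), φ s r := by
  have e1 : ∫⁻ r in Ioo (0 : ℝ) t, ∫⁻ s in Ioo (0 : ℝ) r, φ s (r - s) =
      ∫⁻ r, ∫⁻ s, (if 0 < s ∧ s < r ∧ r < t then φ s (r - s) else 0) := by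
    rw [← lintegral_indicator measurableSet_Ioo]
    congr 1; funext r
    by_cases hr : r ∈ Ioo 0 t
    · rw [Set.indicator_of_mem hr, ← lintegral_indicator measurableSet_Ioo]
      congr 1; funext s; simp [Set.indicator, hr.2]
    · rw [Set.indicator_of_notMem hr]
      symm
      rw [lintegral_eq_zero_iff' (by
        have : (fun s => if 0 < s ∧ s < r ∧ r < t then φ s (r - s) else 0) = fun _ => 0 := by
          funext s; rw [if_neg]; rintro ⟨h1, h2, h3⟩; exact hr ⟨h1.trans h2, h3⟩
        rw [this]; exact aemeasurable_const)]
      refine ae_of_all _ fun s => ?_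
      simp only [Pi.zero_apply]
      rw [if_neg]; rintro ⟨h1, h2, h3⟩; exact hr ⟨h1.trans h2, h3⟩
  rw [e1, lintegral_lintegral_swap]
  · rw [← lintegral_indicator measurableSet_Ioo]
    congr 1; funext s
    by_cases hs : s ∈ Ioo 0 t
    · rw [Set.indicator_of_mem hs, ← lintegral_add_right_eq_self _ s, ← lintegral_indicator measurableSet_Ioo]
      congr 1; funext r
      simp only [Set.indicator, mem_Ioo, add_sub_cancel_right]
      congr 1
      apply propext
      constructor
      · rintro ⟨h1, h2, h3⟩; constructor <;> linarith
      · rintro ⟨h1, h2⟩; exact ⟨hs.1, by linarith, by linarith⟩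
    · rw [Set.indicator_of_notMem hs]
      have : (fun r => if 0 < s ∧ s < r ∧ r < t then φ s (r - s) else 0) = fun _ => 0 := by
        funext r; rw [if_neg]; rintro ⟨h1, h2, h3⟩; exact hs ⟨h1, h2.trans h3⟩
      rw [this, lintegral_zero]
  · apply Measurable.aemeasurable
    simp only [Function.uncurry_def]
    refine Measurable.ite ?_ (P_comp hφ (by fun_prop) (by fun_prop)) measurable_const
    exact (measurableSet_lt measurable_const measurable_snd).inter
      ((measurableSet_lt measurable_snd measurable_fst).inter (measurableSet_lt measurable_fst measurable_const))

theorem PE_succ_apply {E : Type*} [MeasureSpace E] [SFinite (volume : Measure E)] {k : ℝ → E → E → ℝ≥0∞}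
    {q f : E → ℝ≥0∞} (hk : Measurable (fun p : ℝ × E × E => k p.1 p.2.1 p.2.2)) (hq : Measurable q)
    (hf : Measurable f) (x : E) (n : ℕ) (t : ℝ) :
    ∫⁻ y, PE k q x (n + 1) t y * f y =
      ∫⁻ s in Ioo (0 : ℝ) t, ∫⁻ z, PE k q x n s z * q z * ∫⁻ y, k (t - s) z y * f y := by
  have hP := PE_meas hk hq x n
  have hm3 : Measurable (fun w : (E × ℝ) × E => PE k q x n w.1.2 w.2 * q w.2 * k (t - w.1.2) w.2 w.1.1) :=
    ((P_comp hP (by fun_prop) (by fun_prop)).mul (hq.comp measurable_snd)).mul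
      (k_comp hk (by fun_prop) (by fun_prop) (by fun_prop))
  have hm2 : Measurable (fun w : E × ℝ => ∫⁻ z, PE k q x n w.2 z * q z * k (t - w.2) z w.1) :=
    hm3.lintegral_prod_right'
  calc ∫⁻ y, PE k q x (n + 1) t y * f y
      = ∫⁻ y, ∫⁻ s in Ioo (0 : ℝ) t, (∫⁻ z, PE k q x n s z * q z * k (t - s) z y) * f y := by
        congr 1; funext y
        have hm : Measurable (fun s => ∫⁻ z, PE k q x n s z * q z * k (t - s) z y) :=
          hm2.comp (measurable_prodMk_left (x := y))
        rw [lintegral_mul_const _ hm]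
        rfl
    _ = ∫⁻ s in Ioo (0 : ℝ) t, ∫⁻ y, (∫⁻ z, PE k q x n s z * q z * k (t - s) z y) * f y := by
        rw [lintegral_lintegral_swap]
        exact (hm2.mul (hf.comp measurable_fst)).aemeasurable
    _ = _ := by
        congr 1; funext s
        have hm4 : Measurable (fun w : E × E => PE k q x n s w.2 * q w.2 * k (t - s) w.2 w.1) :=
          ((P_comp hP (by fun_prop) (by fun_prop)).mul (hq.comp measurable_snd)).mul
            (k_comp hk (by fun_prop) (by fun_prop) (by fun_prop))
        calc ∫⁻ y, (∫⁻ z, PE k q x n s z * q z * k (t - s) z y) * f y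
            = ∫⁻ y, ∫⁻ z, PE k q x n s z * q z * k (t - s) z y * f y := by
              congr 1; funext y
              have hm : Measurable (fun z => PE k q x n s z * q z * k (t - s) z y) :=
                hm4.comp (measurable_prodMk_left (x := y))
              rw [lintegral_mul_const _ hm]
          _ = ∫⁻ z, ∫⁻ y, PE k q x n s z * q z * k (t - s) z y * f y := by
              rw [lintegral_lintegral_swap]
              exact (hm4.mul (hf.comp measurable_fst)).aemeasurable
          _ = _ := by
              congr 1; funext z
              have hm : Measurable (fun y => k (t - s) z y * f y) :=
                (k_comp hk measurable_const measurable_const measurable_id).mul hf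
              rw [← lintegral_const_mul _ hm]
              congr 1; funext y; ring

theorem PE_step {E : Type*} [MeasureSpace E] [SFinite (volume : Measure E)] {k : ℝ → E → E → ℝ≥0∞}
    {q H : E → ℝ≥0∞} (hk : Measurable (fun p : ℝ × E × E => k p.1 p.2.1 p.2.2)) (hq : Measurable q)
    (hH : Measurable H)
    (star : ∀ t, 0 < t → ∀ x, (∫⁻ y, k t x y * H y) + ∫⁻ s in Ioo (0 : ℝ) t, ∫⁻ z, k s x z * (q z * H z) ≤ H x)
    (x : E) (n : ℕ) (t : ℝ) :
    (∫⁻ y, PE k q x (n + 1) t y * H y) + ∫⁻ s in Ioo (0 : ℝ) t, ∫⁻ z, PE k q x (n + 1) s z * (q z * H z) ≤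
      ∫⁻ s in Ioo (0 : ℝ) t, ∫⁻ z, PE k q x n s z * (q z * H z) := by
  have hP := PE_meas hk hq x n
  have hqH : Measurable (fun z => q z * H z) := hq.mul hH
  have hK : ∀ f : E → ℝ≥0∞, Measurable f → Measurable (fun p : ℝ × E => ∫⁻ y, k p.1 p.2 y * f y) := by
    intro f hf
    apply Measurable.lintegral_prod_right' (f := fun w : (ℝ × E) × E => k w.1.1 w.1.2 w.2 * f w.2)
    exact (k_comp hk (by fun_prop) (by fun_prop) (by fun_prop)).mul (hf.comp measurable_snd)
  have h1 := PE_succ_apply hk hq hH x n t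
  have h2 : ∫⁻ s in Ioo (0 : ℝ) t, ∫⁻ z, PE k q x (n + 1) s z * (q z * H z) =
      ∫⁻ s in Ioo (0 : ℝ) t, ∫⁻ z, PE k q x n s z * q z * ∫⁻ r in Ioo (0 : ℝ) (t - s), ∫⁻ y, k r z y * (q y * H y) := by
    simp_rw [PE_succ_apply hk hq hqH x n]
    rw [triangle_swap (fun s r => ∫⁻ z, PE k q x n s z * q z * ∫⁻ y, k r z y * (q y * H y))]
    · congr 1; funext s
      rw [lintegral_lintegral_swap]
      · congr 1; funext z
        rw [lintegral_const_mul]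
        exact P_comp (P := fun r z => ∫⁻ y, k r z y * (q y * H y)) (hK _ hqH) measurable_id measurable_const
      · apply Measurable.aemeasurable
        simp only [Function.uncurry_def]
        exact ((P_comp hP (by fun_prop) (by fun_prop)).mul (hq.comp measurable_snd)).mul
          (P_comp (P := fun r z => ∫⁻ y, k r z y * (q y * H y)) (hK _ hqH) measurable_fst measurable_snd)
    · apply Measurable.lintegral_prod_right'
        (f := fun w : (ℝ × ℝ) × E => PE k q x n w.1.1 w.2 * q w.2 * ∫⁻ y, k w.1.2 w.2 y * (q y * H y))
      exact ((P_comp hP (by fun_prop) (by fun_prop)).mul (hq.comp measurable_snd)).mul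
          (P_comp (P := fun r z => ∫⁻ y, k r z y * (q y * H y)) (hK _ hqH) (by fun_prop) (by fun_prop))
  have mA : Measurable (fun p : ℝ × E => PE k q x n p.1 p.2 * q p.2 * ∫⁻ y, k (t - p.1) p.2 y * H y) :=
    (hP.mul (hq.comp measurable_snd)).mul
      (P_comp (P := fun r z => ∫⁻ y, k r z y * H y) (hK _ hH) (by fun_prop) (by fun_prop))
  rw [h1, h2, ← lintegral_add_left mA.lintegral_prod_right']
  refine setLIntegral_mono' measurableSet_Ioo fun s hs => ?_
  have mB : Measurable (fun z => PE k q x n s z * q z * ∫⁻ y, k (t - s) z y * H y) :=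
    mA.comp (measurable_prodMk_left (x := s))
  simp only []
  rw [← lintegral_add_left mB]
  refine lintegral_mono fun z => ?_
  rw [← mul_add, ← mul_assoc]
  exact mul_le_mul_right (star (t - s) (by linarith [hs.2]) z) _

theorem PE_total {E : Type*} [MeasureSpace E] [SFinite (volume : Measure E)] {k : ℝ → E → E → ℝ≥0∞}
    {q H : E → ℝ≥0∞} (hk : Measurable (fun p : ℝ × E × E => k p.1 p.2.1 p.2.2)) (hq : Measurable q)
    (hH : Measurable H)
    (star : ∀ t, 0 < t → ∀ x, (∫⁻ y, k t x y * H y) + ∫⁻ s in Ioo (0 : ℝ) t, ∫⁻ z, k s x z * (q z * H z) ≤ H x)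
    (x : E) (t : ℝ) (ht : 0 < t) :
    ∫⁻ y, (∑' n, PE k q x n t y) * H y ≤ H x := by
  have hS : ∀ n, (∑ i ∈ Finset.range (n + 1), ∫⁻ y, PE k q x i t y * H y) +
      ∫⁻ s in Ioo (0 : ℝ) t, ∫⁻ z, PE k q x n s z * (q z * H z) ≤ H x := by
    intro n
    induction n with
    | zero => simpa [PE] using star t ht x
    | succ n ih =>
      rw [Finset.sum_range_succ, add_assoc]
      exact (add_le_add_right (PE_step hk hq hH star x n t) _).trans ih
  have hm : ∀ n, Measurable (fun y => PE k q x n t y) := fun n =>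
    P_comp (PE_meas hk hq x n) measurable_const measurable_id
  simp_rw [← ENNReal.tsum_mul_right]
  rw [lintegral_tsum fun n => (show AEMeasurable (fun y => PE k q x n t y * H y) _ from ((hm n).mul hH).aemeasurable)]
  refine ENNReal.tsum_le_of_sum_range_le fun n => ?_
  exact (Finset.sum_le_sum_of_subset (Finset.range_mono (Nat.le_succ n))).trans (le_self_add.trans (hS n))

theorem rpow_layer (e v m : ℝ) (he : 0 < e) (hm : 0 ≤ m) (hmv : m ≤ v) :
    ∫⁻ s in Ioo (0 : ℝ) m, ENNReal.ofReal (e * (v - s) ^ (e - 1)) =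
      ENNReal.ofReal (v ^ e - (v - m) ^ e) := by
  have hI : IntervalIntegrable (fun s : ℝ => e * (v - s) ^ (e - 1)) volume 0 m := by
    have h := (intervalIntegral.intervalIntegrable_rpow' (a := v - 0) (b := v - m)
      (r := e - 1) (by linarith))
    have h2 := (h.comp_sub_left v)
    simp only [sub_sub_cancel] at h2
    exact h2.const_mul e
  have hI2 : IntegrableOn (fun s : ℝ => e * (v - s) ^ (e - 1)) (Ioo 0 m) := by
    rw [← integrableOn_Ioc_iff_integrableOn_Ioo]
    exact (intervalIntegrable_iff_integrableOn_Ioc_of_le hm).1 hI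
  rw [← ofReal_integral_eq_lintegral_ofReal hI2]
  · congr 1
    rw [← integral_Ioc_eq_integral_Ioo, ← intervalIntegral.integral_of_le hm,
      intervalIntegral.integral_const_mul,
      intervalIntegral.integral_comp_sub_left (fun s : ℝ => s ^ (e - 1)) v,
      integral_rpow (Or.inl (by linarith))]
    rw [sub_add_cancel, sub_zero]
    field_simp
  · refine (ae_restrict_iff' measurableSet_Ioo).2 (ae_of_all _ fun s hs => ?_)
    have : 0 ≤ v - s := by linarith [hs.2]
    simp only [Pi.zero_apply]
    positivity

theorem pot_shift {E : Type*} [MeasureSpace E] [SFinite (volume : Measure E)] {k : ℝ → E → E → ℝ≥0∞}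
    (hk : Measurable (fun p : ℝ × E × E => k p.1 p.2.1 p.2.2))
    (CK : ∀ s t, 0 < s → 0 < t → ∀ x y, ∫⁻ z, k s x z * k t z y ≤ k (s + t) x y) (o : E)
    (φ : ℝ → ℝ≥0∞) (hφ : Measurable φ) (t : ℝ) (ht : 0 < t) (x : E) :
    ∫⁻ z, k t x z * ∫⁻ u in Ioi (0 : ℝ), φ u * k u z o ≤
      ∫⁻ v, (if t < v then φ (v - t) else 0) * k v x o := by
  have m1 : ∀ z, Measurable (fun u => φ u * k u z o) := fun z =>
    hφ.mul (k_comp hk measurable_id measurable_const measurable_const)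
  have m2 : ∀ u, Measurable (fun z => k t x z * k u z o) := fun u =>
    (k_comp hk measurable_const measurable_const measurable_id).mul
      (k_comp hk measurable_const measurable_id measurable_const)
  calc ∫⁻ z, k t x z * ∫⁻ u in Ioi (0 : ℝ), φ u * k u z o
      = ∫⁻ z, ∫⁻ u in Ioi (0 : ℝ), k t x z * (φ u * k u z o) := by
        congr 1; funext z
        rw [lintegral_const_mul _ (m1 z)]
    _ = ∫⁻ u in Ioi (0 : ℝ), ∫⁻ z, k t x z * (φ u * k u z o) := by
        rw [lintegral_lintegral_swap]
        apply Measurable.aemeasurable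
        exact (k_comp hk measurable_const measurable_const measurable_fst).mul
          ((hφ.comp measurable_snd).mul (k_comp hk measurable_snd measurable_fst measurable_const))
    _ ≤ ∫⁻ u in Ioi (0 : ℝ), φ u * k (u + t) x o := by
        refine setLIntegral_mono' measurableSet_Ioi fun u hu => ?_
        have : ∀ z, k t x z * (φ u * k u z o) = φ u * (k t x z * k u z o) := fun z => by ring
        simp_rw [this]
        rw [lintegral_const_mul _ (m2 u), add_comm u t]
        exact mul_le_mul_right (CK t u ht hu x o) _
    _ = _ := by
        rw [← lintegral_add_right_eq_self (fun v => (if t < v then φ (v - t) else 0) * k v x o) t,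
          ← lintegral_indicator measurableSet_Ioi]
        congr 1; funext u
        by_cases hu : 0 < u
        · rw [Set.indicator_of_mem (show u ∈ Ioi 0 from hu), if_pos (by linarith), add_sub_cancel_right]
        · rw [Set.indicator_of_notMem (show u ∉ Ioi 0 from hu), if_neg (by linarith), zero_mul]

theorem star_abs {E : Type*} [MeasureSpace E] [SFinite (volume : Measure E)] {k : ℝ → E → E → ℝ≥0∞}
    (hk : Measurable (fun p : ℝ × E × E => k p.1 p.2.1 p.2.2))
    (CK : ∀ s t, 0 < s → 0 < t → ∀ x y, ∫⁻ z, k s x z * k t z y ≤ k (s + t) x y) (o : E)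
    (e : ℝ) (he : 0 < e) (t : ℝ) (ht : 0 < t) (x : E) :
    (∫⁻ y, k t x y * ∫⁻ u in Ioi (0 : ℝ), ENNReal.ofReal (u ^ e) * k u y o) +
      ∫⁻ s in Ioo (0 : ℝ) t, ∫⁻ z, k s x z * ∫⁻ u in Ioi (0 : ℝ), ENNReal.ofReal (e * u ^ (e - 1)) * k u z o ≤
    ∫⁻ u in Ioi (0 : ℝ), ENNReal.ofReal (u ^ e) * k u x o := by
  have mφ : Measurable (fun u : ℝ => ENNReal.ofReal (u ^ e)) := by fun_prop
  have mψ : Measurable (fun u : ℝ => ENNReal.ofReal (e * u ^ (e - 1))) := by fun_prop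
  have mk : Measurable (fun v => k v x o) := k_comp hk measurable_id measurable_const measurable_const
  have mif : Measurable (fun p : ℝ × ℝ => if p.1 < p.2 then ENNReal.ofReal (e * (p.2 - p.1) ^ (e - 1)) else 0) :=
    Measurable.ite (measurableSet_lt measurable_fst measurable_snd)
      (mψ.comp (measurable_snd.sub measurable_fst)) measurable_const
  have mA : Measurable (fun v : ℝ => (if t < v then ENNReal.ofReal ((v - t) ^ e) else 0) * k v x o) :=
    (Measurable.ite (measurableSet_lt measurable_const measurable_id)
      (mφ.comp (measurable_id.sub measurable_const)) measurable_const).mul mk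
  have b2 : ∫⁻ s in Ioo (0 : ℝ) t, ∫⁻ z, k s x z * ∫⁻ u in Ioi (0 : ℝ), ENNReal.ofReal (e * u ^ (e - 1)) * k u z o ≤
      ∫⁻ v, (∫⁻ s in Ioo (0 : ℝ) t, if s < v then ENNReal.ofReal (e * (v - s) ^ (e - 1)) else 0) * k v x o := by
    refine (setLIntegral_mono' measurableSet_Ioo fun s hs => pot_shift hk CK o _ mψ s hs.1 x).trans ?_
    rw [lintegral_lintegral_swap]
    · refine le_of_eq ?_
      congr 1; funext v
      have mv : Measurable (fun s => if s < v then ENNReal.ofReal (e * (v - s) ^ (e - 1)) else 0) :=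
        mif.comp (measurable_id.prodMk measurable_const)
      rw [lintegral_mul_const _ mv]
    · exact (mif.mul (mk.comp measurable_snd)).aemeasurable
  refine (add_le_add (pot_shift hk CK o _ mφ t ht x) b2).trans ?_
  rw [← lintegral_add_left mA, ← lintegral_indicator measurableSet_Ioi]
  refine lintegral_mono fun v => ?_
  simp only []
  rw [← add_mul]
  have hB : ∀ v, 0 < v → ∫⁻ s in Ioo (0 : ℝ) t, (if s < v then ENNReal.ofReal (e * (v - s) ^ (e - 1)) else 0) =
      ENNReal.ofReal (v ^ e - (v - min t v) ^ e) := by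
    intro v hv
    rw [← rpow_layer e v (min t v) he (le_min ht.le hv.le) (min_le_right _ _),
      ← lintegral_indicator measurableSet_Ioo, ← lintegral_indicator measurableSet_Ioo]
    congr 1; funext s
    simp only [Set.indicator, mem_Ioo, lt_min_iff]
    by_cases h1 : 0 < s <;> by_cases h2 : s < t <;> by_cases h3 : s < v <;> simp [h1, h2, h3]
  by_cases hv : 0 < v
  · rw [Set.indicator_of_mem (show v ∈ Ioi 0 from hv), hB v hv]
    refine mul_le_mul_left ?_ _
    by_cases htv : t < v
    · rw [if_pos htv, min_eq_left htv.le, ← ENNReal.ofReal_add]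
      · simp
      · exact Real.rpow_nonneg (by linarith) _
      · exact sub_nonneg.2 (Real.rpow_le_rpow (by linarith) (by linarith) he.le)
    · rw [if_neg htv, min_eq_right (not_lt.1 htv), sub_self, Real.zero_rpow he.ne', sub_zero, zero_add]
  · have h0 : ∫⁻ s in Ioo (0 : ℝ) t, (if s < v then ENNReal.ofReal (e * (v - s) ^ (e - 1)) else 0) = 0 := by
      refine (setLIntegral_congr_fun (g := fun _ => 0) measurableSet_Ioo fun s hs => ?_).trans lintegral_zero
      rw [if_neg]; intro h; exact hv (hs.1.trans h)
    rw [h0, if_neg (by intro h; exact hv (ht.trans h)), add_zero, zero_mul]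
    exact zero_le

theorem ofReal_integral_le {X : Type*} [MeasurableSpace X] (μ : Measure X) (f : X → ℝ) :
    ENNReal.ofReal (∫ x, f x ∂μ) ≤ ∫⁻ x, ENNReal.ofReal (f x) ∂μ := by
  by_cases hf : Integrable f μ
  · rw [integral_eq_lintegral_pos_part_sub_lintegral_neg_part hf]
    refine (ENNReal.ofReal_le_ofReal (sub_le_self _ ENNReal.toReal_nonneg)).trans ?_
    exact ENNReal.ofReal_toReal_le
  · rw [integral_undef hf]; simp

theorem pertN_le {d : ℕ} {k : ℝ → Ed d → Ed d → ℝ} {q : Ed d → ℝ} (hk : ∀ t, 0 < t → ∀ x y, 0 ≤ k t x y)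
    (hq : ∀ x, 0 ≤ q x) (x : Ed d) (n : ℕ) : ∀ t, 0 < t → ∀ y, 0 ≤ pertN d k q n t x y ∧
    ENNReal.ofReal (pertN d k q n t x y) ≤
      PE (fun t x y => ENNReal.ofReal (k t x y)) (fun z => ENNReal.ofReal (q z)) x n t y := by
  induction n with
  | zero => intro t ht y; exact ⟨hk t ht x y, le_rfl⟩
  | succ n ih =>
    intro t ht y
    simp only [pertN, PE]
    constructor
    · refine setIntegral_nonneg measurableSet_Ioo fun s hs => integral_nonneg fun z => ?_
      exact mul_nonneg (mul_nonneg (ih s hs.1 z).1 (hq z)) (hk _ (by linarith [hs.2]) _ _)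
    · refine (ofReal_integral_le _ _).trans (setLIntegral_mono' measurableSet_Ioo fun s hs => ?_)
      refine (ofReal_integral_le _ _).trans (lintegral_mono fun z => ?_)
      simp only []
      rw [ENNReal.ofReal_mul (mul_nonneg (ih s hs.1 z).1 (hq z)), ENNReal.ofReal_mul (ih s hs.1 z).1]
      gcongr
      exact (ih s hs.1 z).2

theorem pert_le {d : ℕ} {k : ℝ → Ed d → Ed d → ℝ} {q : Ed d → ℝ} (hk : ∀ t, 0 < t → ∀ x y, 0 ≤ k t x y)
    (hq : ∀ x, 0 ≤ q x) (x : Ed d) (t : ℝ) (ht : 0 < t) (y : Ed d) : 0 ≤ pert d k q t x y ∧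
    ENNReal.ofReal (pert d k q t x y) ≤
      ∑' n, PE (fun t x y => ENNReal.ofReal (k t x y)) (fun z => ENNReal.ofReal (q z)) x n t y := by
  have h := fun n => pertN_le hk hq x n t ht y
  refine ⟨tsum_nonneg fun n => (h n).1, ?_⟩
  unfold pert
  by_cases hs : Summable fun n => pertN d k q n t x y
  · rw [ENNReal.ofReal_tsum_of_nonneg (fun n => (h n).1) hs]
    exact ENNReal.tsum_le_tsum fun n => (h n).2
  · rw [tsum_eq_zero_of_not_summable hs]; simp

theorem relKernel_eq (d : ℕ) (α t : ℝ) (x y : Ed d) :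
    relKernel d α 1 t x y = pk d (α / 2) t (y - x) := by
  unfold relKernel pk II
  simp

theorem relK_nonneg (d : ℕ) (α t : ℝ) (h0 : 0 < α) (h2 : α < 2) (ht : 0 < t) (x y : Ed d) :
    0 ≤ relKernel d α 1 t x y := by
  rw [relKernel_eq]
  exact pk_nonneg d _ t (by linarith) (by linarith) ht _

theorem relK_meas (d : ℕ) (α : ℝ) :
    Measurable (fun p : ℝ × Ed d × Ed d => ENNReal.ofReal (relKernel d α 1 p.1 p.2.1 p.2.2)) := by
  simp_rw [relKernel_eq]
  exact (pk_meas_comp d (α / 2) (fun p : ℝ × Ed d × Ed d => p.1) (fun p => p.2.2 - p.2.1) (by fun_prop)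
    (by fun_prop)).ennreal_ofReal

theorem relK_CK (d : ℕ) (α s t : ℝ) (h0 : 0 < α) (h2 : α < 2) (hs : 0 < s) (ht : 0 < t) (x y : Ed d) :
    ∫⁻ z, ENNReal.ofReal (relKernel d α 1 s x z) * ENNReal.ofReal (relKernel d α 1 t z y) ≤
      ENNReal.ofReal (relKernel d α 1 (s + t) x y) := by
  simp_rw [relKernel_eq]
  rw [← lintegral_add_right_eq_self _ x]
  refine le_trans (le_of_eq ?_) (pk_CK d (α / 2) s t (by linarith) (by linarith) hs ht (y - x))
  congr 1; funext z
  rw [add_sub_cancel_right, show y - (z + x) = y - x - z by abel]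

/-- The integral in the definition of the modified Bessel function. -/
def JJ (ν r : ℝ) : ℝ := ∫ u in Ioi (0 : ℝ), u ^ (-ν - 1) * Real.exp (-u - r ^ 2 / (4 * u))

theorem JJ_eq (d : ℕ) (β : ℝ) (x : Ed d) :
    ∫ s in Ioi (0 : ℝ), s ^ (((d : ℝ) - β) / 2 - 1) * (Real.exp (-s) * gk d s (0 - x)) =
      (4 * π) ^ (-((d : ℝ) / 2)) * JJ (β / 2) ‖x‖ := by
  unfold JJ
  rw [← integral_const_mul]
  refine setIntegral_congr_fun measurableSet_Ioi fun s hs => ?_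
  have hs : 0 < s := hs
  simp only [gk]
  rw [zero_sub, norm_neg, Real.mul_rpow (by positivity) hs.le, sub_eq_add_neg (-s), Real.exp_add,
    show -(β / 2) - 1 = (((d : ℝ) - β) / 2 - 1) + (-((d : ℝ) / 2)) by ring, Real.rpow_add hs]
  ring

theorem JJ_pos (d : ℕ) (β : ℝ) (hβ : β < d) (x : Ed d) (hx : x ≠ 0) : 0 < JJ (β / 2) ‖x‖ := by
  have h := pot_int_pos d (((d : ℝ) - β) / 2) (by linarith) (0 - x) (by simpa using hx)
  rw [JJ_eq] at h
  exact (pos_iff_pos_of_mul_pos h).1 (by positivity)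

theorem hBeta_pk (d : ℕ) (α β : ℝ) (h0 : 0 < α) (x : Ed d) :
    hBeta d α β x = ∫ t in Ioi (0 : ℝ), t ^ (((d : ℝ) - β) / α - 1) * pk d (α / 2) t (0 - x) := by
  unfold hBeta hBetaM
  simp_rw [relKernel_eq]
  rw [show ((d : ℝ) - α - β) / α = ((d : ℝ) - β) / α - 1 by field_simp; ring]

theorem hBeta_formula (d : ℕ) (α β : ℝ) (h0 : 0 < α) (h2 : α < 2) (hβ : β < d) (x : Ed d) (hx : x ≠ 0) :
    hBeta d α β x = Real.Gamma (((d : ℝ) - β) / α) / Real.Gamma (((d : ℝ) - β) / 2) *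
      ((4 * π) ^ (-((d : ℝ) / 2)) * JJ (β / 2) ‖x‖) := by
  rw [hBeta_pk d α β h0, pot_formula d (α / 2) _ (by linarith) (by linarith)
    (div_pos (by linarith) h0) (0 - x) (by simpa using hx),
    show α / 2 * (((d : ℝ) - β) / α) = ((d : ℝ) - β) / 2 by field_simp, JJ_eq]

theorem hBeta_pos (d : ℕ) (α β : ℝ) (h0 : 0 < α) (h2 : α < 2) (hβ : β < d) (x : Ed d) (hx : x ≠ 0) :
    0 < hBeta d α β x := by
  rw [hBeta_formula d α β h0 h2 hβ x hx]
  have := JJ_pos d β hβ x hx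
  have h1 := Real.Gamma_pos_of_pos (show 0 < ((d : ℝ) - β) / α from div_pos (by linarith) h0)
  have h3 := Real.Gamma_pos_of_pos (show 0 < ((d : ℝ) - β) / 2 by linarith)
  positivity

theorem V_mul_h (d : ℕ) (α δ : ℝ) (h0 : 0 < α) (h2 : α < 2) (hδ : δ < d - α) (x : Ed d)
    (hx : x ≠ 0) :
    Vbeta d α δ x * hBeta d α δ x = ((d : ℝ) - α - δ) / α * hBeta d α (δ + α) x := by
  rw [hBeta_formula d α δ h0 h2 (by linarith) x hx, hBeta_formula d α (δ + α) h0 h2 (by linarith) x hx]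
  have hJ0 := JJ_pos d δ (by linarith) x hx
  have hJ1 := JJ_pos d (δ + α) (by linarith) x hx
  have he : 0 < ((d : ℝ) - α - δ) / α := div_pos (by linarith) h0
  have hG : Real.Gamma (((d : ℝ) - δ) / α) = ((d : ℝ) - α - δ) / α * Real.Gamma (((d : ℝ) - (δ + α)) / α) := by
    rw [show ((d : ℝ) - δ) / α = ((d : ℝ) - α - δ) / α + 1 by field_simp; ring, Real.Gamma_add_one he.ne',
      show (d : ℝ) - (δ + α) = d - α - δ by ring]
  have g1 := Real.Gamma_pos_of_pos (show 0 < ((d : ℝ) - δ) / 2 by linarith)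
  have g2 := Real.Gamma_pos_of_pos (show 0 < ((d : ℝ) - δ - α) / 2 by linarith)
  have hr : 0 < ‖x‖ := norm_pos_iff.2 hx
  have hK0 : besselK (δ / 2) ‖x‖ = 1 / 2 * (‖x‖ / 2) ^ (δ / 2) * JJ (δ / 2) ‖x‖ := rfl
  have hK1 : besselK ((δ + α) / 2) ‖x‖ =
      1 / 2 * ((‖x‖ / 2) ^ (δ / 2) * (‖x‖ / 2) ^ (α / 2)) * JJ ((δ + α) / 2) ‖x‖ := by
    rw [← Real.rpow_add (by positivity), ← add_div]; rfl
  unfold Vbeta VProf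
  rw [hK0, hK1, hG, Real.div_rpow hr.le (by norm_num) (α / 2), Real.rpow_neg hr.le,
    show (d : ℝ) - (δ + α) = d - δ - α by ring]
  have p1 : 0 < ‖x‖ ^ (α / 2) := by positivity
  have p2 : (0 : ℝ) < 2 ^ (α / 2) := by positivity
  have p3 : 0 < (‖x‖ / 2) ^ (δ / 2) := by positivity
  field_simp

theorem JJ_nonneg (ν r : ℝ) : 0 ≤ JJ ν r :=
  setIntegral_nonneg measurableSet_Ioi fun u hu => by
    have : 0 < u := hu
    positivity

theorem besselK_nonneg (ν r : ℝ) (hr : 0 ≤ r) : 0 ≤ besselK ν r := by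
  have : besselK ν r = 1 / 2 * (r / 2) ^ ν * JJ ν r := rfl
  rw [this]
  have := JJ_nonneg ν r
  positivity

theorem Vbeta_nonneg (d : ℕ) (α δ : ℝ) (h0 : 0 < α) (hδ : δ < d - α) (x : Ed d) : 0 ≤ Vbeta d α δ x := by
  unfold Vbeta VProf
  have g1 := Real.Gamma_pos_of_pos (show 0 < ((d : ℝ) - δ) / 2 by linarith)
  have g2 := Real.Gamma_pos_of_pos (show 0 < ((d : ℝ) - δ - α) / 2 by linarith)
  have := besselK_nonneg ((δ + α) / 2) ‖x‖ (norm_nonneg _)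
  have := besselK_nonneg (δ / 2) ‖x‖ (norm_nonneg _)
  positivity

theorem besselK_meas (ν : ℝ) : Measurable (besselK ν) := by
  unfold besselK
  refine Measurable.mul (by fun_prop) ?_
  have hm : StronglyMeasurable (fun p : ℝ × ℝ => p.2 ^ (-ν - 1) * Real.exp (-p.2 - p.1 ^ 2 / (4 * p.2))) := by
    apply Measurable.stronglyMeasurable
    fun_prop
  exact (hm.integral_prod_right' (ν := volume.restrict (Ioi (0 : ℝ)))).measurable

theorem Vbeta_meas (d : ℕ) (α δ : ℝ) : Measurable (Vbeta d α δ) := by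
  unfold Vbeta VProf
  have h1 : Measurable (fun x : Ed d => besselK ((δ + α) / 2) ‖x‖) := (besselK_meas _).comp measurable_norm
  have h2 : Measurable (fun x : Ed d => besselK (δ / 2) ‖x‖) := (besselK_meas _).comp measurable_norm
  exact ((h1.div h2).const_mul _).mul (by fun_prop)

theorem ofReal_hBeta (d : ℕ) (α β : ℝ) (h0 : 0 < α) (h2 : α < 2) (hβ : β < d) (x : Ed d) (hx : x ≠ 0) :
    ENNReal.ofReal (hBeta d α β x) = ∫⁻ u in Ioi (0 : ℝ), ENNReal.ofReal (u ^ (((d : ℝ) - α - β) / α)) *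
      ENNReal.ofReal (relKernel d α 1 u x 0) := by
  have hI := (reg_limit d (α / 2) (((d : ℝ) - β) / α) (by linarith) (by linarith)
    (div_pos (by linarith) h0) (0 - x) (by simpa using hx)).1
  rw [hBeta_pk d α β h0, ofReal_integral_eq_lintegral_ofReal hI]
  · refine setLIntegral_congr_fun measurableSet_Ioi fun u hu => ?_
    have hu : 0 < u := hu
    rw [ENNReal.ofReal_mul (by positivity), relKernel_eq,
      show ((d : ℝ) - α - β) / α = ((d : ℝ) - β) / α - 1 by field_simp; ring]
  · refine (ae_restrict_iff' measurableSet_Ioi).2 (ae_of_all _ fun u hu => ?_)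
    have hu : 0 < u := hu
    have := pk_nonneg d (α / 2) u (by linarith) (by linarith) hu (0 - x)
    simp only [Pi.zero_apply]
    positivity

/-- `h_δ` is supermedian for the perturbed semigroup (Corollary 2.5). -/
theorem stmt_4 (d : ℕ) (α δ : ℝ) (hα : α ∈ Ioo 0 (min 2 (d : ℝ)))
    (hδ : δ ∈ Ioo 0 ((d : ℝ) - α)) (t : ℝ) (ht : 0 < t) (x : Ed d) (hx : x ≠ 0) :
    (∫ y : Ed d, pert d (relKernel d α 1) (Vbeta d α δ) t x y * hBeta d α δ y) ≤
      hBeta d α δ x := by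
  have h0 : 0 < α := hα.1
  have h2 : α < 2 := hα.2.trans_le (min_le_left _ _)
  have hd : α < d := hα.2.trans_le (min_le_right _ _)
  have hδ1 : δ < d - α := hδ.2
  have hδd : δ < d := by linarith
  have : Nonempty (Fin d) := by
    rw [← Fin.pos_iff_nonempty]
    have : (0 : ℝ) < d := h0.trans hd
    exact_mod_cast this
  have he : 0 < ((d : ℝ) - α - δ) / α := div_pos (by linarith) h0
  have hne : ∀ᵐ y : Ed d, y ≠ 0 := Measure.ae_ne volume 0
  set k : ℝ → Ed d → Ed d → ℝ≥0∞ := fun t x y => ENNReal.ofReal (relKernel d α 1 t x y) with hkdef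
  set q : Ed d → ℝ≥0∞ := fun z => ENNReal.ofReal (Vbeta d α δ z) with hqdef
  set H : Ed d → ℝ≥0∞ := fun z => ∫⁻ u in Ioi (0 : ℝ), ENNReal.ofReal (u ^ (((d : ℝ) - α - δ) / α)) * k u z 0
    with hHdef
  have hk : Measurable (fun p : ℝ × Ed d × Ed d => k p.1 p.2.1 p.2.2) := relK_meas d α
  have hq : Measurable q := (Vbeta_meas d α δ).ennreal_ofReal
  have hH : Measurable H := by
    apply Measurable.lintegral_prod_right'
      (f := fun p : Ed d × ℝ => ENNReal.ofReal (p.2 ^ (((d : ℝ) - α - δ) / α)) * k p.2 p.1 0)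
    exact (Measurable.ennreal_ofReal (by fun_prop)).mul (k_comp hk measurable_snd measurable_fst measurable_const)
  have hHh : ∀ y, y ≠ 0 → ENNReal.ofReal (hBeta d α δ y) = H y := fun y hy =>
    ofReal_hBeta d α δ h0 h2 hδd y hy
  have hqH : ∀ᵐ z : Ed d, q z * H z = ∫⁻ u in Ioi (0 : ℝ),
      ENNReal.ofReal (((d : ℝ) - α - δ) / α * u ^ (((d : ℝ) - α - δ) / α - 1)) * k u z 0 := by
    filter_upwards [hne] with z hz
    rw [← hHh z hz, hqdef, ← ENNReal.ofReal_mul (Vbeta_nonneg d α δ h0 hδ1 z), V_mul_h d α δ h0 h2 hδ1 z hz,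
      ENNReal.ofReal_mul he.le, ofReal_hBeta d α (δ + α) h0 h2 (by linarith) z hz]
    have hmu : Measurable (fun u : ℝ => ENNReal.ofReal (u ^ (((d : ℝ) - α - (δ + α)) / α)) *
        ENNReal.ofReal (relKernel d α 1 u z 0)) :=
      (Measurable.ennreal_ofReal (by fun_prop)).mul
        (k_comp hk measurable_id measurable_const measurable_const)
    rw [← lintegral_const_mul _ hmu]
    congr 1; funext u
    rw [ENNReal.ofReal_mul he.le, mul_assoc,
      show ((d : ℝ) - α - (δ + α)) / α = ((d : ℝ) - α - δ) / α - 1 by field_simp; ring]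
  have star : ∀ t, 0 < t → ∀ x, (∫⁻ y, k t x y * H y) +
      ∫⁻ s in Ioo (0 : ℝ) t, ∫⁻ z, k s x z * (q z * H z) ≤ H x := by
    intro t ht x
    refine le_trans (le_of_eq ?_) (star_abs hk (fun s t hs ht x y => relK_CK d α s t h0 h2 hs ht x y) 0 _ he t ht x)
    congr 2
    funext s
    refine lintegral_congr_ae ?_
    filter_upwards [hqH] with z hz
    rw [hz]
  have tot := PE_total hk hq hH star x t ht
  have hpl := fun y => pert_le (fun t ht x y => relK_nonneg d α t h0 h2 ht x y)
    (Vbeta_nonneg d α δ h0 hδ1) x t ht y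
  rw [← ENNReal.ofReal_le_ofReal_iff (hBeta_pos d α δ h0 h2 hδd x hx).le, hHh x hx]
  refine (ofReal_integral_le _ _).trans (le_trans (lintegral_mono_ae ?_) tot)
  filter_upwards [hne] with y hy
  rw [ENNReal.ofReal_mul (hpl y).1, hHh y hy]
  exact mul_le_mul_left (hpl y).2 _
end
end

section
/- Let d ∈ ℕ and α ∈ (0, min(2,d)). For every β ∈ (0, d) and every x ∈ ℝ^d \ {0}, h_β(x) = (2^{β/2+1} Γ((d-β)/α) / ((4π)^{d/2} Γ((d-β)/2))) · |x|^{-β/2} K_{β/2}(|x|). Moreover, the radial profile r ↦ h_β(r) is decreasing on (0,∞). -/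
open MeasureTheory Real Set Filter RealInnerProductSpace

noncomputable section

lemma aux_choose_sign (γ : ℝ) (h0 : 0 < γ) (h1 : γ < 1) (k : ℕ) :
    (-1) ^ (k + 1) * (descPochhammer ℝ (k + 1)).eval γ ≤ 0 := by
  induction k with
  | zero => simp [h0.le]
  | succ k ih =>
    rw [descPochhammer_succ_eval, pow_succ]
    have : (0:ℝ) ≤ (k + 1 : ℕ) - γ := by push_cast; nlinarith [(Nat.cast_nonneg k : (0:ℝ) ≤ k)]
    nlinarith

lemma aux_choose_sign' (γ : ℝ) (h0 : 0 < γ) (h1 : γ < 1) (k : ℕ) :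
    (-1) ^ (k + 1) * Ring.choose γ (k + 1) ≤ 0 := by
  rw [Ring.choose_eq_smul, smul_eq_mul]
  have := aux_choose_sign γ h0 h1 k
  rw [← Polynomial.aeval_eq_smeval, Polynomial.aeval_def, Polynomial.eval₂_eq_eval_map,
    descPochhammer_map]
  have h2 : (0:ℝ) ≤ ((Nat.factorial (k + 1) : ℕ) : ℝ)⁻¹ := by positivity
  nlinarith

/-- Functions on `[0,1)` that are countable nonnegative combinations of powers. -/
def AbsMon (f : ℝ → ℝ) : Prop :=
  ∃ (ι : Type) (_ : Countable ι) (a : ι → ℝ) (n : ι → ℕ), (∀ i, 0 ≤ a i) ∧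
    ∀ q, 0 ≤ q → q < 1 → HasSum (fun i => a i * q ^ n i) (f q)

lemma AbsMon.mul {f g : ℝ → ℝ} (hf : AbsMon f) (hg : AbsMon g) : AbsMon (fun q => f q * g q) := by
  obtain ⟨ι, _, a, n, ha, h⟩ := hf
  obtain ⟨κ, _, b, m, hb, h'⟩ := hg
  refine ⟨ι × κ, inferInstance, fun p => a p.1 * b p.2, fun p => n p.1 + m p.2,
    fun p => mul_nonneg (ha _) (hb _), fun q h0 h1 => ?_⟩
  have h2 := (h q h0 h1).mul (h' q h0 h1) ((h q h0 h1).summable.mul_of_nonneg (h' q h0 h1).summable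
    (fun i => mul_nonneg (ha i) (by positivity)) (fun i => mul_nonneg (hb i) (by positivity)))
  refine Eq.subst (motive := fun F => HasSum F (f q * g q)) (funext fun p => ?_) h2
  simp only [pow_add]
  ring

lemma AbsMon.pow {f : ℝ → ℝ} (hf : AbsMon f) (k : ℕ) : AbsMon (fun q => f q ^ k) := by
  induction k with
  | zero =>
    refine ⟨Unit, inferInstance, fun _ => 1, fun _ => 0, by simp, fun q _ _ => ?_⟩
    simpa only [pow_zero, mul_one] using hasSum_unique (fun _ : Unit => (1:ℝ))
  | succ k ih => simpa only [pow_succ] using ih.mul hf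

lemma absMon_base (γ c : ℝ) (h0 : 0 < γ) (h1 : γ < 1) (hc0 : 0 ≤ c) (hc1 : c ≤ 1) :
    AbsMon (fun q => 1 - c * (1 - q) ^ γ) := by
  refine ⟨ℕ, inferInstance,
    fun k => (if k = 0 then 1 else 0) - c * ((-1) ^ k * Ring.choose γ k), fun k => k, ?_, ?_⟩
  · rintro (_ | k)
    · simpa using hc1
    · simp only [Nat.add_eq_zero_iff, one_ne_zero, and_false, if_false]
      nlinarith [aux_choose_sign' γ h0 h1 k]
  · intro q hq0 hq1
    have h := (Real.one_add_rpow_hasFPowerSeriesOnBall_zero (a := γ)).hasSum (y := -q)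
      (by simp [← ofReal_norm, abs_of_nonneg hq0, hq1])
    simp only [binomialSeries_apply, List.ofFn_const, List.prod_replicate, zero_add, smul_eq_mul] at h
    have h2 : HasSum (fun k : ℕ => if k = 0 then (1:ℝ) else 0) 1 := hasSum_ite_eq 0 1
    have h3 := h2.sub (h.mul_left c)
    rw [← sub_eq_add_neg] at h3
    refine Eq.subst (motive := fun F => HasSum F (1 - c * (1 - q) ^ γ)) (funext fun k => ?_) h3
    rcases k with _ | k
    · simp
    · simp only [Nat.add_eq_zero_iff, one_ne_zero, and_false, if_false, neg_pow q]
      ring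

lemma exp_bound (p c b : ℝ) (hp : 0 < p) (hc : 0 < c) (hb : 0 < b) :
    (1 / b) ^ p * Real.exp (-(c / b)) ≤ (p / c) ^ p := by
  have h1 : c / b / p ≤ Real.exp (c / b / p) := by
    linarith [Real.add_one_le_exp (c / b / p)]
  have h2 : (c / b / p) ^ p ≤ Real.exp (c / b) := by
    calc (c / b / p) ^ p ≤ (Real.exp (c / b / p)) ^ p :=
          Real.rpow_le_rpow (by positivity) h1 hp.le
      _ = _ := by rw [← Real.exp_mul]; congr 1; field_simp
  have h3 : (1 / b) ^ p = (p / c) ^ p * (c / b / p) ^ p := by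
    rw [← Real.mul_rpow (by positivity) (by positivity)]; congr 1; field_simp
  rw [h3, mul_assoc, Real.exp_neg]
  have : (c / b / p) ^ p * (Real.exp (c / b))⁻¹ ≤ 1 := by
    rw [← div_eq_mul_inv, div_le_one (Real.exp_pos _)]; exact h2
  exact mul_le_of_le_one_right (by positivity) this

lemma gauss_integrable (d : ℕ) (b : ℝ) (hb : 0 < b) :
    Integrable (fun z : Ed d => Real.exp (-b * ‖z‖ ^ 2)) := by
  have h := (GaussianFourier.integrable_cexp_neg_mul_sq_norm_add (V := Ed d)
    (b := (b : ℂ)) (by simpa using hb) 0 0).re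
  refine h.congr (Eventually.of_forall fun z => ?_)
  simp only [zero_mul, add_zero]
  have : -(b : ℂ) * (‖z‖ : ℂ) ^ 2 = ((-b * ‖z‖ ^ 2 : ℝ) : ℂ) := by push_cast; ring
  rw [this]
  exact Complex.exp_ofReal_re _

lemma gauss_fourier (d : ℕ) (x : Ed d) (b : ℝ) (hb : 0 < b) :
    ∫ z : Ed d, Real.cos ⟪x, z⟫ * Real.exp (-b * ‖z‖ ^ 2) =
      (π / b) ^ ((d : ℝ) / 2) * Real.exp (-(‖x‖ ^ 2 / 4 / b)) := by
  have hi := (GaussianFourier.integrable_cexp_neg_mul_sq_norm_add (V := Ed d)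
    (b := (b : ℂ)) (by simpa using hb) Complex.I x)
  have h := (GaussianFourier.integral_cexp_neg_mul_sq_norm_add (V := Ed d)
    (b := (b : ℂ)) (by simpa using hb) Complex.I x)
  have h2 := congrArg Complex.re h
  rw [← RCLike.re_eq_complex_re, ← integral_re hi] at h2
  have h3 : ((π : ℂ) / b) ^ ((Module.finrank ℝ (Ed d) : ℂ) / 2) *
      Complex.exp (Complex.I ^ 2 * (‖x‖ : ℂ) ^ 2 / (4 * b)) =
      (((π / b) ^ ((d : ℝ) / 2) * Real.exp (-(‖x‖ ^ 2 / 4 / b)) : ℝ) : ℂ) := by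
    rw [Complex.ofReal_mul, Complex.ofReal_cpow (by positivity)]
    push_cast
    rw [finrank_euclideanSpace, Fintype.card_fin, Complex.I_sq]
    congr 2
    field_simp
  rw [h3] at h2
  rw [← Complex.ofReal_re ((π / b) ^ ((d : ℝ) / 2) * Real.exp (-(‖x‖ ^ 2 / 4 / b)))]
  rw [RCLike.re_eq_complex_re] at h2
  rw [← h2]
  congr 1
  ext z
  have : -(b : ℂ) * (‖z‖ : ℂ) ^ 2 + Complex.I * ((⟪x, z⟫ : ℝ) : ℂ) =
    ((-b * ‖z‖ ^ 2 : ℝ) : ℂ) + ((⟪x, z⟫ : ℝ) : ℂ) * Complex.I := by push_cast; ring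
  rw [this, Complex.exp_add_mul_I, ← Complex.ofReal_exp, ← Complex.ofReal_cos,
    ← Complex.ofReal_sin]
  rw [Complex.re_ofReal_mul, Complex.add_re, Complex.ofReal_re, Complex.re_ofReal_mul, Complex.I_re]
  ring

lemma gauss_bound (d : ℕ) (hd : 0 < d) (x : Ed d) (hx : x ≠ 0) :
    ∃ C : ℝ, 0 ≤ C ∧ ∀ b : ℝ, 0 < b →
      |(π / b) ^ ((d : ℝ) / 2) * Real.exp (-(‖x‖ ^ 2 / 4 / b))| ≤ C := by
  have hx' : 0 < ‖x‖ := norm_pos_iff.2 hx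
  have hd' : (0:ℝ) < d := by exact_mod_cast hd
  refine ⟨π ^ ((d : ℝ) / 2) * (((d : ℝ) / 2) / (‖x‖ ^ 2 / 4)) ^ ((d : ℝ) / 2), by positivity,
    fun b hb => ?_⟩
  rw [abs_of_nonneg (by positivity)]
  have := exp_bound ((d : ℝ) / 2) (‖x‖ ^ 2 / 4) b (by positivity) (by positivity) hb
  rw [div_eq_mul_one_div, Real.mul_rpow (by positivity) (by positivity), mul_assoc]
  gcongr

lemma key_absMon (d : ℕ) (x : Ed d) (C : ℝ)
    (hC : ∀ b : ℝ, 0 < b → |(π / b) ^ ((d : ℝ) / 2) * Real.exp (-(‖x‖ ^ 2 / 4 / b))| ≤ C)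
    (f : ℝ → ℝ) (hf : AbsMon f) (δ ε : ℝ) (hδ : 0 < δ) (hε : 0 < ε) :
    |∫ z : Ed d, Real.cos ⟪x, z⟫ * Real.exp (-ε * ‖z‖ ^ 2) * f (Real.exp (-δ * (‖z‖ ^ 2 + 1)))| ≤
      C * f (Real.exp (-δ)) := by
  obtain ⟨ι, _, a, n, ha, h⟩ := hf
  have hq : ∀ z : Ed d, HasSum (fun i => a i * Real.exp (-δ * (‖z‖ ^ 2 + 1)) ^ n i)
      (f (Real.exp (-δ * (‖z‖ ^ 2 + 1)))) := fun z => by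
    refine h _ (Real.exp_pos _).le (Real.exp_lt_one_iff.2 ?_)
    have : 0 < δ * (‖z‖ ^ 2 + 1) := by positivity
    linarith
  have hq1 := h (Real.exp (-δ)) (Real.exp_pos _).le (Real.exp_lt_one_iff.2 (by linarith))
  set F : ι → Ed d → ℝ := fun i z =>
    (a i * Real.exp (-δ) ^ n i) * (Real.cos ⟪x, z⟫ * Real.exp (-(ε + δ * n i) * ‖z‖ ^ 2)) with hF
  have hFeq : ∀ i z, F i z = Real.cos ⟪x, z⟫ * Real.exp (-ε * ‖z‖ ^ 2) *
      (a i * Real.exp (-δ * (‖z‖ ^ 2 + 1)) ^ n i) := by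
    intro i z
    have : Real.exp (-δ) ^ n i * Real.exp (-(ε + δ * n i) * ‖z‖ ^ 2) =
        Real.exp (-ε * ‖z‖ ^ 2) * Real.exp (-δ * (‖z‖ ^ 2 + 1)) ^ n i := by
      rw [← Real.exp_nat_mul, ← Real.exp_nat_mul, ← Real.exp_add, ← Real.exp_add]
      congr 1; ring
    simp only [hF]
    linear_combination (a i * Real.cos ⟪x, z⟫) * this
  have hb : ∀ i, 0 < ε + δ * n i := fun i => by positivity
  have hcosint : ∀ b : ℝ, 0 < b →
      Integrable (fun z : Ed d => Real.cos ⟪x, z⟫ * Real.exp (-b * ‖z‖ ^ 2)) := fun b hb => by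
    refine (gauss_integrable d b hb).mono' (by fun_prop) (Eventually.of_forall fun z => ?_)
    rw [norm_mul, Real.norm_eq_abs, Real.norm_eq_abs, Real.abs_exp]
    exact mul_le_of_le_one_left (Real.exp_pos _).le (Real.abs_cos_le_one _)
  have hFint : ∀ i, Integrable (F i) := fun i => (hcosint _ (hb i)).const_mul _
  have hnorm : ∀ i, ∫ z, ‖F i z‖ ≤
      (a i * Real.exp (-δ) ^ n i) * ∫ z : Ed d, Real.exp (-ε * ‖z‖ ^ 2) := fun i => by
    rw [← integral_const_mul]
    refine integral_mono (hFint i).norm ((gauss_integrable d ε hε).const_mul _) fun z => ?_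
    have h0 : 0 ≤ a i * Real.exp (-δ) ^ n i := mul_nonneg (ha i) (by positivity)
    simp only [hF, norm_mul, Real.norm_eq_abs, Real.abs_exp]
    rw [← abs_mul, abs_of_nonneg h0]
    refine mul_le_mul_of_nonneg_left ?_ h0
    refine (mul_le_of_le_one_left (Real.exp_pos _).le (Real.abs_cos_le_one _)).trans ?_
    refine Real.exp_le_exp.2 ?_
    have : 0 ≤ δ * n i * ‖z‖ ^ 2 := by positivity
    nlinarith
  have hsum : Summable (fun i => ∫ z, ‖F i z‖) :=
    Summable.of_nonneg_of_le (fun i => integral_nonneg fun z => norm_nonneg _) hnorm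
      (hq1.summable.mul_right _)
  have hS := hasSum_integral_of_summable_integral_norm hFint hsum
  have hpt : ∀ z, ∑' i, F i z = Real.cos ⟪x, z⟫ * Real.exp (-ε * ‖z‖ ^ 2) *
      f (Real.exp (-δ * (‖z‖ ^ 2 + 1))) := fun z => by
    simp only [hFeq]
    exact ((hq z).mul_left _).tsum_eq
  simp only [hpt] at hS
  rw [← hS.tsum_eq, ← Real.norm_eq_abs]
  refine tsum_of_norm_bounded (hq1.mul_left C) fun i => ?_
  simp only [hF]
  rw [integral_const_mul, gauss_fourier d x _ (hb i), norm_mul, Real.norm_eq_abs, Real.norm_eq_abs,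
    abs_of_nonneg (mul_nonneg (ha i) (by positivity)), mul_comm]
  exact mul_le_mul_of_nonneg_right (hC _ (hb i)) (mul_nonneg (ha i) (by positivity))

lemma key_lim (d : ℕ) (x : Ed d) (C ε : ℝ) (hε : 0 < ε) (f : ℝ → ℝ) (g : ℕ → ℝ → ℝ)
    (hg : ∀ n, Measurable (g n)) (hg1 : ∀ᶠ n in atTop, ∀ l, 1 ≤ l → |g n l| ≤ 1)
    (hlim : ∀ l, 1 ≤ l → Tendsto (fun n => g n l) atTop (nhds (f l)))
    (hb : ∀ᶠ n in atTop, |∫ z : Ed d, Real.cos ⟪x, z⟫ * Real.exp (-ε * ‖z‖ ^ 2) *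
      g n (‖z‖ ^ 2 + 1)| ≤ C * g n 1) :
    |∫ z : Ed d, Real.cos ⟪x, z⟫ * Real.exp (-ε * ‖z‖ ^ 2) * f (‖z‖ ^ 2 + 1)| ≤ C * f 1 := by
  have h1 : Tendsto (fun n => ∫ z : Ed d, Real.cos ⟪x, z⟫ * Real.exp (-ε * ‖z‖ ^ 2) *
      g n (‖z‖ ^ 2 + 1)) atTop
      (nhds (∫ z : Ed d, Real.cos ⟪x, z⟫ * Real.exp (-ε * ‖z‖ ^ 2) * f (‖z‖ ^ 2 + 1))) := by
    refine tendsto_integral_filter_of_dominated_convergence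
      (fun z => Real.exp (-ε * ‖z‖ ^ 2)) ?_ ?_ (gauss_integrable d ε hε) ?_
    · refine Eventually.of_forall fun n => ?_
      have := hg n
      have h2 : Measurable (fun z : Ed d => g n (‖z‖ ^ 2 + 1)) := by fun_prop
      have h3 : Measurable (fun z : Ed d => Real.cos ⟪x, z⟫ * Real.exp (-ε * ‖z‖ ^ 2)) := by
        fun_prop
      exact (h3.mul h2).aestronglyMeasurable
    · filter_upwards [hg1] with n hn
      refine Eventually.of_forall fun z => ?_
      rw [norm_mul, norm_mul, Real.norm_eq_abs, Real.norm_eq_abs, Real.norm_eq_abs, Real.abs_exp]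
      have h2 := hn (‖z‖ ^ 2 + 1) (by nlinarith [sq_nonneg ‖z‖])
      have h3 := Real.abs_cos_le_one ⟪x, z⟫
      have h4 := Real.exp_pos (-ε * ‖z‖ ^ 2)
      calc _ ≤ 1 * Real.exp (-ε * ‖z‖ ^ 2) * 1 := by gcongr
        _ = _ := by ring
    · refine Eventually.of_forall fun z => ?_
      exact (hlim _ (by nlinarith [sq_nonneg ‖z‖])).const_mul _
  exact le_of_tendsto_of_tendsto h1.abs ((hlim 1 le_rfl).const_mul C) hb

lemma key_exp (d : ℕ) (x : Ed d) (C : ℝ)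
    (hC : ∀ b : ℝ, 0 < b → |(π / b) ^ ((d : ℝ) / 2) * Real.exp (-(‖x‖ ^ 2 / 4 / b))| ≤ C)
    (γ T δ ε : ℝ) (h0 : 0 < γ) (h1 : γ < 1) (hT : 0 ≤ T) (hδ : 0 < δ) (hε : 0 < ε) :
    |∫ z : Ed d, Real.cos ⟪x, z⟫ * Real.exp (-ε * ‖z‖ ^ 2) *
      (fun l => Real.exp (-(T * (1 - Real.exp (-δ * l)) ^ γ))) (‖z‖ ^ 2 + 1)| ≤
      C * (fun l => Real.exp (-(T * (1 - Real.exp (-δ * l)) ^ γ))) 1 := by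
  refine key_lim d x C ε hε (fun l => Real.exp (-(T * (1 - Real.exp (-δ * l)) ^ γ)))
    (fun n l => (1 - T / n * (1 - Real.exp (-δ * l)) ^ γ) ^ n) ?_ ?_ ?_ ?_
  · intro n; fun_prop
  · filter_upwards [eventually_ge_atTop (⌈T⌉₊), eventually_gt_atTop 0] with n hn hn0 l hl
    have hn' : T ≤ n := (Nat.le_ceil T).trans (by exact_mod_cast hn)
    have hn0' : (0:ℝ) < n := by exact_mod_cast hn0
    have h2 : Real.exp (-δ * l) ≤ 1 := Real.exp_le_one_iff.2 (by nlinarith)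
    have h3 : (1 - Real.exp (-δ * l)) ^ γ ≤ 1 :=
      Real.rpow_le_one (by linarith) (by linarith [Real.exp_pos (-δ * l)]) h0.le
    have h4 : 0 ≤ (1 - Real.exp (-δ * l)) ^ γ := Real.rpow_nonneg (by linarith) _
    have h5 : T / n ≤ 1 := (div_le_one hn0').2 hn'
    have h6 : 0 ≤ T / n := by positivity
    have h7 : T / n * (1 - Real.exp (-δ * l)) ^ γ ≤ 1 := mul_le_one₀ h5 h4 h3
    have h8 : 0 ≤ T / n * (1 - Real.exp (-δ * l)) ^ γ := mul_nonneg h6 h4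
    rw [abs_of_nonneg (pow_nonneg (by linarith) _)]
    exact pow_le_one₀ (by linarith) (by linarith)
  · intro l hl
    have := Real.tendsto_one_add_div_pow_exp (-(T * (1 - Real.exp (-δ * l)) ^ γ))
    refine this.congr fun n => ?_
    congr 1; ring
  · filter_upwards [eventually_ge_atTop (⌈T⌉₊), eventually_gt_atTop 0] with n hn hn0
    have hn' : T ≤ n := (Nat.le_ceil T).trans (by exact_mod_cast hn)
    have hn0' : (0:ℝ) < n := by exact_mod_cast hn0
    have h5 : T / n ≤ 1 := (div_le_one hn0').2 hn'
    have h6 : 0 ≤ T / n := by positivity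
    have := key_absMon d x C hC _ ((absMon_base γ (T / n) h0 h1 h6 h5).pow n) δ ε hδ hε
    simpa only [mul_one] using this

lemma key_stable (d : ℕ) (x : Ed d) (C : ℝ)
    (hC : ∀ b : ℝ, 0 < b → |(π / b) ^ ((d : ℝ) / 2) * Real.exp (-(‖x‖ ^ 2 / 4 / b))| ≤ C)
    (γ t ε : ℝ) (h0 : 0 < γ) (h1 : γ < 1) (ht : 0 ≤ t) (hε : 0 < ε) :
    |∫ z : Ed d, Real.cos ⟪x, z⟫ * Real.exp (-ε * ‖z‖ ^ 2) *
      Real.exp (-(t * (‖z‖ ^ 2 + 1) ^ γ))| ≤ C * Real.exp (-t) := by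
  have := key_lim d x C ε hε (fun l => Real.exp (-(t * l ^ γ)))
    (fun n l => Real.exp (-((t * ((n:ℝ) + 1) ^ γ) * (1 - Real.exp (-(1 / ((n:ℝ) + 1)) * l)) ^ γ)))
    ?_ ?_ ?_ ?_
  · simpa using this
  · intro n; fun_prop
  · refine Eventually.of_forall fun n l hl => ?_
    rw [Real.abs_exp, Real.exp_le_one_iff]
    have h2 : Real.exp (-(1 / ((n:ℝ) + 1)) * l) ≤ 1 := Real.exp_le_one_iff.2 (by
      have : 0 ≤ (1 / ((n:ℝ) + 1)) * l := by positivity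
      linarith)
    have h4 : 0 ≤ (1 - Real.exp (-(1 / ((n:ℝ) + 1)) * l)) ^ γ := Real.rpow_nonneg (by linarith) _
    have : 0 ≤ (t * ((n:ℝ) + 1) ^ γ) * (1 - Real.exp (-(1 / ((n:ℝ) + 1)) * l)) ^ γ := by positivity
    linarith
  · intro l hl
    have hder : HasDerivAt (fun s : ℝ => 1 - Real.exp (-s * l)) l 0 := by
      have := (((hasDerivAt_id (0:ℝ)).neg.mul_const l).exp).const_sub 1
      simpa using this
    rw [hasDerivAt_iff_tendsto_slope_zero] at hder
    have hseq : Tendsto (fun n : ℕ => 1 / ((n:ℝ) + 1)) atTop (nhdsWithin 0 {0}ᶜ) :=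
      tendsto_nhdsWithin_iff.2 ⟨tendsto_one_div_add_atTop_nhds_zero_nat,
        Eventually.of_forall fun n => by simp; positivity⟩
    have h2 := hder.comp hseq
    have h3 : Tendsto (fun n : ℕ => -(t * (((n:ℝ) + 1) * (1 - Real.exp (-(1 / ((n:ℝ) + 1)) * l))) ^ γ))
        atTop (nhds (-(t * l ^ γ))) := by
      refine ((Tendsto.rpow_const ?_ (Or.inr h0.le)).const_mul t).neg
      refine h2.congr fun n => ?_
      simp
    refine (Real.continuous_exp.tendsto _).comp h3 |>.congr fun n => ?_
    simp only [Function.comp]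
    have h2 : Real.exp (-(1 / ((n:ℝ) + 1)) * l) ≤ 1 := Real.exp_le_one_iff.2 (by
      have : 0 ≤ (1 / ((n:ℝ) + 1)) * l := by positivity
      linarith)
    rw [Real.mul_rpow (by positivity) (by linarith), mul_assoc]
  · refine Eventually.of_forall fun n => ?_
    exact key_exp d x C hC γ _ _ ε h0 h1 (by positivity) (by positivity) hε

lemma gamma_integrable (a : ℝ) (ha : 0 < a) :
    Integrable (fun t : ℝ => t ^ (a - 1) * Real.exp (-t)) (volume.restrict (Ioi 0)) :=
  (Real.GammaIntegral_convergent ha).congr (Eventually.of_forall fun t => mul_comm _ _)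

lemma fub (d : ℕ) (x : Ed d) (φ : Ed d → ℝ) (hφ : Continuous φ) (h1 : ∀ z, 1 ≤ φ z) (a ε : ℝ)
    (ha : 0 < a) (hε : 0 < ε) :
    ∫ t in Ioi (0:ℝ), t ^ (a - 1) *
      ∫ z : Ed d, Real.cos ⟪x, z⟫ * Real.exp (-ε * ‖z‖ ^ 2) * Real.exp (-(t * φ z)) =
    Real.Gamma a *
      ∫ z : Ed d, Real.cos ⟪x, z⟫ * Real.exp (-ε * ‖z‖ ^ 2) * (φ z) ^ (-a) := by
  have hint : Integrable (Function.uncurry fun (t : ℝ) (z : Ed d) => t ^ (a - 1) *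
      (Real.cos ⟪x, z⟫ * Real.exp (-ε * ‖z‖ ^ 2) * Real.exp (-(t * φ z))))
      ((volume.restrict (Ioi 0)).prod volume) := by
    refine ((gamma_integrable a ha).mul_prod (gauss_integrable d ε hε)).mono' ?_ ?_
    · have h2 : Measurable (fun q : ℝ × Ed d => Real.cos ⟪x, q.2⟫ * Real.exp (-ε * ‖q.2‖ ^ 2) *
        Real.exp (-(q.1 * φ q.2))) := by
        refine Continuous.measurable ?_
        fun_prop
      have h3 : Measurable (fun q : ℝ × Ed d => q.1 ^ (a - 1)) := by fun_prop
      exact (h3.mul h2).aestronglyMeasurable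
    · have h4 : ∀ᵐ q : ℝ × Ed d ∂((volume.restrict (Ioi 0)).prod volume), q.1 ∈ Ioi (0:ℝ) :=
        Measure.quasiMeasurePreserving_fst.ae (ae_restrict_mem measurableSet_Ioi)
      filter_upwards [h4] with q hq
      obtain ⟨t, z⟩ := q
      have ht : 0 < t := hq
      simp only [Function.uncurry, norm_mul, Real.norm_eq_abs, Real.abs_exp]
      rw [abs_of_nonneg (Real.rpow_nonneg ht.le _), mul_assoc (t ^ (a - 1)) (Real.exp (-t))]
      refine mul_le_mul_of_nonneg_left ?_ (Real.rpow_nonneg ht.le _)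
      have h5 := Real.abs_cos_le_one ⟪x, z⟫
      have h6 : Real.exp (-(t * φ z)) ≤ Real.exp (-t) :=
        Real.exp_le_exp.2 (by nlinarith [h1 z])
      calc _ ≤ 1 * Real.exp (-ε * ‖z‖ ^ 2) * Real.exp (-t) := by gcongr
        _ = _ := by ring
  simp_rw [← integral_const_mul]
  rw [integral_integral_swap hint]
  congr 1
  ext z
  have hz : 0 < φ z := lt_of_lt_of_le one_pos (h1 z)
  have := Real.integral_rpow_mul_exp_neg_mul_Ioi ha hz
  calc _ = ∫ t in Ioi (0:ℝ), (Real.cos ⟪x, z⟫ * Real.exp (-ε * ‖z‖ ^ 2)) *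
        (t ^ (a - 1) * Real.exp (-(φ z * t))) := by
        congr 1; ext t; rw [mul_comm (φ z) t]; ring
    _ = _ := by
        rw [integral_const_mul, this, one_div, Real.inv_rpow hz.le, Real.rpow_neg hz.le]; ring

lemma stable_integrable (d : ℕ) (γ t : ℝ) (h0 : 0 < γ) (ht : 0 < t) :
    Integrable (fun z : Ed d => Real.exp (-(t * (‖z‖ ^ 2 + 1) ^ γ))) := by
  have hfin : (Module.finrank ℝ (Ed d) : ℝ) < (d : ℝ) + 1 := by simp
  have h := integrable_rpow_neg_one_add_norm_sq (E := Ed d) (μ := volume) hfin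
  set p : ℝ := ((d : ℝ) + 1) / 2 / γ with hp
  have hp0 : 0 < p := by positivity
  have hm : Measurable (fun z : Ed d => Real.exp (-(t * (‖z‖ ^ 2 + 1) ^ γ))) := by fun_prop
  refine (h.const_mul ((p / t) ^ p)).mono' hm.aestronglyMeasurable
    (Eventually.of_forall fun z => ?_)
  rw [Real.norm_eq_abs, Real.abs_exp]
  have hl : 0 < ‖z‖ ^ 2 + 1 := by positivity
  have hb := exp_bound p t ((‖z‖ ^ 2 + 1) ^ γ)⁻¹ hp0 ht (by positivity)
  rw [one_div, inv_inv, div_inv_eq_mul, ← Real.rpow_mul hl.le] at hb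
  have e : γ * p = ((d : ℝ) + 1) / 2 := by rw [hp]; field_simp
  rw [e] at hb
  rw [neg_div, Real.rpow_neg (by positivity), ← div_eq_mul_inv, le_div_iff₀ (by positivity),
    add_comm 1, mul_comm]
  exact hb

lemma main_limit (d : ℕ) (hd : 0 < d) (γ s p : ℝ) (h0 : 0 < γ) (h1 : γ < 1) (hs : 0 < s)
    (hp : p = γ * s) (x : Ed d) (hx : x ≠ 0) :
    Real.Gamma p * ∫ t in Ioi (0:ℝ), t ^ (s - 1) *
      ∫ z : Ed d, Real.cos ⟪x, z⟫ * Real.exp (-(t * (‖z‖ ^ 2 + 1) ^ γ)) =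
    Real.Gamma s * ∫ u in Ioi (0:ℝ), u ^ (p - 1) * (Real.exp (-u) *
      ((π / u) ^ ((d : ℝ) / 2) * Real.exp (-(‖x‖ ^ 2 / 4 / u)))) := by
  obtain ⟨C, hC0, hC⟩ := gauss_bound d hd x hx
  have hp0 : 0 < p := by rw [hp]; positivity
  set e : ℕ → ℝ := fun n => 1 / ((n:ℝ) + 1) with he
  have hepos : ∀ n, 0 < e n := fun n => by simp only [he]; positivity
  have helim : Tendsto e atTop (nhds 0) := tendsto_one_div_add_atTop_nhds_zero_nat
  -- first limit
  have L1 : Tendsto (fun n => ∫ t in Ioi (0:ℝ), t ^ (s - 1) *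
      ∫ z : Ed d, Real.cos ⟪x, z⟫ * Real.exp (-e n * ‖z‖ ^ 2) *
        Real.exp (-(t * (‖z‖ ^ 2 + 1) ^ γ))) atTop
      (nhds (∫ t in Ioi (0:ℝ), t ^ (s - 1) *
      ∫ z : Ed d, Real.cos ⟪x, z⟫ * Real.exp (-(t * (‖z‖ ^ 2 + 1) ^ γ)))) := by
    refine tendsto_integral_of_dominated_convergence
      (fun t => C * (t ^ (s - 1) * Real.exp (-t))) ?_ ((gamma_integrable s hs).const_mul C) ?_ ?_
    · intro n
      have h2 : StronglyMeasurable (Function.uncurry fun (t : ℝ) (z : Ed d) => Real.cos ⟪x, z⟫ *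
          Real.exp (-e n * ‖z‖ ^ 2) * Real.exp (-(t * (‖z‖ ^ 2 + 1) ^ γ))) := by
        refine Measurable.stronglyMeasurable ?_
        simp only [Function.uncurry_def]
        fun_prop
      have h3 := h2.integral_prod_right (ν := (volume : Measure (Ed d)))
      have h4 : Measurable (fun t : ℝ => t ^ (s - 1)) := by fun_prop
      exact (h4.stronglyMeasurable.mul h3).aestronglyMeasurable
    · intro n
      filter_upwards [ae_restrict_mem measurableSet_Ioi] with t ht
      have ht : 0 < t := ht
      rw [norm_mul, Real.norm_eq_abs, Real.norm_eq_abs, abs_of_nonneg (Real.rpow_nonneg ht.le _)]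
      have := key_stable d x C hC γ t (e n) h0 h1 ht.le (hepos n)
      calc _ ≤ t ^ (s - 1) * (C * Real.exp (-t)) := by gcongr
        _ = _ := by ring
    · filter_upwards [ae_restrict_mem measurableSet_Ioi] with t ht
      have ht : 0 < t := ht
      refine Tendsto.const_mul _ ?_
      refine tendsto_integral_of_dominated_convergence _ ?_ (stable_integrable d γ t h0 ht) ?_ ?_
      · intro n
        refine Measurable.aestronglyMeasurable ?_
        fun_prop
      · intro n
        refine Eventually.of_forall fun z => ?_
        rw [norm_mul, norm_mul, Real.norm_eq_abs, Real.norm_eq_abs, Real.norm_eq_abs,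
          Real.abs_exp, Real.abs_exp]
        have h3 := Real.abs_cos_le_one ⟪x, z⟫
        have h4 : Real.exp (-e n * ‖z‖ ^ 2) ≤ 1 := Real.exp_le_one_iff.2 (by
          have : 0 ≤ e n * ‖z‖ ^ 2 := mul_nonneg (hepos n).le (by positivity)
          linarith)
        calc _ ≤ 1 * 1 * Real.exp (-(t * (‖z‖ ^ 2 + 1) ^ γ)) := by gcongr
          _ = _ := by ring
      · refine Eventually.of_forall fun z => ?_
        refine Tendsto.mul_const _ ?_
        have : Tendsto (fun n => Real.cos ⟪x, z⟫ * Real.exp (-e n * ‖z‖ ^ 2)) atTop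
            (nhds (Real.cos ⟪x, z⟫ * Real.exp (-0 * ‖z‖ ^ 2))) :=
          ((Real.continuous_exp.tendsto _).comp (helim.neg.mul_const _)).const_mul _
        simpa using this
  have L2 : Tendsto (fun n => ∫ u in Ioi (0:ℝ), u ^ (p - 1) *
      ∫ z : Ed d, Real.cos ⟪x, z⟫ * Real.exp (-e n * ‖z‖ ^ 2) *
        Real.exp (-(u * (‖z‖ ^ 2 + 1)))) atTop
      (nhds (∫ u in Ioi (0:ℝ), u ^ (p - 1) * (Real.exp (-u) *
      ((π / u) ^ ((d : ℝ) / 2) * Real.exp (-(‖x‖ ^ 2 / 4 / u)))))) := by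
    have hG : ∀ n u, 0 < u → ∫ z : Ed d, Real.cos ⟪x, z⟫ * Real.exp (-e n * ‖z‖ ^ 2) *
        Real.exp (-(u * (‖z‖ ^ 2 + 1))) = Real.exp (-u) * ((π / (u + e n)) ^ ((d : ℝ) / 2) *
          Real.exp (-(‖x‖ ^ 2 / 4 / (u + e n)))) := by
      intro n u hu
      rw [← gauss_fourier d x (u + e n) (add_pos hu (hepos n)), ← integral_const_mul]
      congr 1
      ext z
      have : Real.exp (-e n * ‖z‖ ^ 2) * Real.exp (-(u * (‖z‖ ^ 2 + 1))) =
          Real.exp (-u) * Real.exp (-(u + e n) * ‖z‖ ^ 2) := by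
        rw [← Real.exp_add, ← Real.exp_add]; congr 1; ring
      linear_combination (Real.cos ⟪x, z⟫) * this
    have hG' : ∀ n, ∫ u in Ioi (0:ℝ), u ^ (p - 1) *
      ∫ z : Ed d, Real.cos ⟪x, z⟫ * Real.exp (-e n * ‖z‖ ^ 2) *
        Real.exp (-(u * (‖z‖ ^ 2 + 1))) = ∫ u in Ioi (0:ℝ), u ^ (p - 1) * (Real.exp (-u) *
        ((π / (u + e n)) ^ ((d : ℝ) / 2) * Real.exp (-(‖x‖ ^ 2 / 4 / (u + e n))))) := fun n =>
      setIntegral_congr_fun measurableSet_Ioi fun u hu => by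
        simp only [hG n u hu]
    simp only [hG']
    refine tendsto_integral_of_dominated_convergence
      (fun t => C * (t ^ (p - 1) * Real.exp (-t))) ?_ ((gamma_integrable p hp0).const_mul C) ?_ ?_
    · intro n
      refine Measurable.aestronglyMeasurable ?_
      fun_prop
    · intro n
      filter_upwards [ae_restrict_mem measurableSet_Ioi] with t ht
      have ht : 0 < t := ht
      rw [norm_mul, norm_mul, Real.norm_eq_abs, Real.norm_eq_abs, Real.norm_eq_abs,
        Real.abs_exp, abs_of_nonneg (Real.rpow_nonneg ht.le _)]
      have := hC (t + e n) (add_pos ht (hepos n))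
      calc _ ≤ t ^ (p - 1) * (Real.exp (-t) * C) := by gcongr
        _ = _ := by ring
    · filter_upwards [ae_restrict_mem measurableSet_Ioi] with t ht
      have ht : 0 < t := ht
      have h5 : Tendsto (fun n => t + e n) atTop (nhds t) := by
        simpa using helim.const_add t
      refine Tendsto.const_mul _ (Tendsto.const_mul _ (Tendsto.mul ?_ ?_))
      · exact (Tendsto.div tendsto_const_nhds h5 ht.ne').rpow_const (Or.inr (by positivity))
      · exact (Real.continuous_exp.tendsto _).comp
          (Tendsto.div tendsto_const_nhds h5 ht.ne').neg
  have hl : ∀ z : Ed d, 1 ≤ ‖z‖ ^ 2 + 1 := fun z => by nlinarith [sq_nonneg ‖z‖]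
  have E : ∀ n, Real.Gamma p * (∫ t in Ioi (0:ℝ), t ^ (s - 1) *
      ∫ z : Ed d, Real.cos ⟪x, z⟫ * Real.exp (-e n * ‖z‖ ^ 2) *
        Real.exp (-(t * (‖z‖ ^ 2 + 1) ^ γ))) = Real.Gamma s * ∫ u in Ioi (0:ℝ), u ^ (p - 1) *
      ∫ z : Ed d, Real.cos ⟪x, z⟫ * Real.exp (-e n * ‖z‖ ^ 2) *
        Real.exp (-(u * (‖z‖ ^ 2 + 1))) := by
    intro n
    rw [fub d x (fun z => (‖z‖ ^ 2 + 1) ^ γ)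
      (Continuous.rpow_const (by fun_prop) fun z => Or.inr h0.le)
      (fun z => Real.one_le_rpow (hl z) h0.le) s (e n) hs (hepos n),
      fub d x (fun z => ‖z‖ ^ 2 + 1) (by fun_prop) hl p (e n) hp0 (hepos n)]
    have : ∀ z : Ed d, ((‖z‖ ^ 2 + 1) ^ γ) ^ (-s) = (‖z‖ ^ 2 + 1) ^ (-p) := fun z => by
      rw [← Real.rpow_mul (by positivity), hp]; congr 1; ring
    simp only [this]
    ring
  have L1' := L1.const_mul (Real.Gamma p)
  simp only [E] at L1'
  exact tendsto_nhds_unique L1' (L2.const_mul (Real.Gamma s))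

lemma bessel_integrable (ν r : ℝ) (hν : 0 < ν) (hr : 0 < r) :
    Integrable (fun u : ℝ => u ^ (-ν - 1) * Real.exp (-u - r ^ 2 / (4 * u)))
      (volume.restrict (Ioi 0)) := by
  have h := (gamma_integrable 1 one_pos).const_mul (((ν + 1) / (r ^ 2 / 4)) ^ (ν + 1))
  have hm : Measurable (fun u : ℝ => u ^ (-ν - 1) * Real.exp (-u - r ^ 2 / (4 * u))) := by fun_prop
  refine h.mono' hm.aestronglyMeasurable ?_
  filter_upwards [ae_restrict_mem measurableSet_Ioi] with u hu
  have hu : 0 < u := hu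
  have hb := exp_bound (ν + 1) (r ^ 2 / 4) u (by linarith) (by positivity) hu
  have e1 : u ^ (-ν - 1) = (1 / u) ^ (ν + 1) := by
    rw [one_div, Real.inv_rpow hu.le, ← Real.rpow_neg hu.le]; congr 1; ring
  have e2 : Real.exp (-u - r ^ 2 / (4 * u)) = Real.exp (-(r ^ 2 / 4 / u)) * Real.exp (-u) := by
    rw [← Real.exp_add]; congr 1; field_simp; ring
  rw [Real.norm_eq_abs, abs_of_nonneg (by positivity), e1, e2, ← mul_assoc]
  simp only [sub_self, Real.rpow_zero, one_mul]
  gcongr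

lemma bessel_strictAnti (ν : ℝ) (hν : 0 < ν) (r₁ r₂ : ℝ) (h1 : 0 < r₁) (h12 : r₁ < r₂) :
    ∫ u in Ioi (0:ℝ), u ^ (-ν - 1) * Real.exp (-u - r₂ ^ 2 / (4 * u)) <
    ∫ u in Ioi (0:ℝ), u ^ (-ν - 1) * Real.exp (-u - r₁ ^ 2 / (4 * u)) := by
  have i1 := bessel_integrable ν r₁ hν h1
  have i2 := bessel_integrable ν r₂ hν (h1.trans h12)
  have hpos : ∀ u : ℝ, 0 < u → 0 < u ^ (-ν - 1) * Real.exp (-u - r₁ ^ 2 / (4 * u)) -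
      u ^ (-ν - 1) * Real.exp (-u - r₂ ^ 2 / (4 * u)) := by
    intro u hu
    rw [← mul_sub]
    refine mul_pos (Real.rpow_pos_of_pos hu _) (sub_pos.2 (Real.exp_lt_exp.2 ?_))
    have : r₁ ^ 2 / (4 * u) < r₂ ^ 2 / (4 * u) := by gcongr
    linarith
  rw [← sub_pos, ← integral_sub i1 i2]
  have i3 : IntegrableOn (fun u : ℝ => u ^ (-ν - 1) * Real.exp (-u - r₁ ^ 2 / (4 * u)) -
      u ^ (-ν - 1) * Real.exp (-u - r₂ ^ 2 / (4 * u))) (Ioi 0) := i1.sub i2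
  rw [setIntegral_pos_iff_support_of_nonneg_ae ?_ i3]
  · have : Ioi (0:ℝ) ⊆ (Function.support fun u : ℝ =>
        u ^ (-ν - 1) * Real.exp (-u - r₁ ^ 2 / (4 * u)) -
        u ^ (-ν - 1) * Real.exp (-u - r₂ ^ 2 / (4 * u))) ∩ Ioi 0 :=
      fun u hu => ⟨(hpos u hu).ne', hu⟩
    refine lt_of_lt_of_le ?_ (measure_mono this)
    simp
  · filter_upwards [ae_restrict_mem measurableSet_Ioi] with u hu
    exact (hpos u hu).le

lemma bessel_simp (ν r : ℝ) (hr : 0 < r) :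
    r ^ (-ν) * besselK ν r = 2 ^ (-ν - 1) *
      ∫ u in Ioi (0 : ℝ), u ^ (-ν - 1) * Real.exp (-u - r ^ 2 / (4 * u)) := by
  unfold besselK
  rw [Real.div_rpow hr.le (by norm_num), Real.rpow_sub (by norm_num), Real.rpow_neg hr.le,
    Real.rpow_neg (by norm_num : (0:ℝ) ≤ 2)]
  have : 0 < r ^ ν := by positivity
  simp only [Real.rpow_one]
  generalize (∫ u in Ioi (0 : ℝ), u ^ (-ν - 1) * Real.exp (-u - r ^ 2 / (4 * u))) = J
  field_simp

/-- Explicit formula for `h_β` and monotonicity of its radial profile (Lemma 2.3). -/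
theorem stmt_5 (d : ℕ) (α β : ℝ) (hα : α ∈ Ioo 0 (min 2 (d : ℝ)))
    (hβ : β ∈ Ioo 0 (d : ℝ)) :
    (∀ x : Ed d, x ≠ 0 →
      hBeta d α β x =
        (2 ^ (β / 2 + 1) * Real.Gamma (((d : ℝ) - β) / α) /
            ((4 * π) ^ ((d : ℝ) / 2) * Real.Gamma (((d : ℝ) - β) / 2))) *
          ‖x‖ ^ (-(β / 2)) * besselK (β / 2) ‖x‖) ∧
    StrictAntiOn
      (fun r : ℝ =>
        (2 ^ (β / 2 + 1) * Real.Gamma (((d : ℝ) - β) / α) /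
            ((4 * π) ^ ((d : ℝ) / 2) * Real.Gamma (((d : ℝ) - β) / 2))) *
          r ^ (-(β / 2)) * besselK (β / 2) r)
      (Ioi 0) := by
  obtain ⟨hα0, hα1⟩ := hα
  obtain ⟨hβ0, hβ1⟩ := hβ
  have hα2 : α < 2 := hα1.trans_le (min_le_left _ _)
  have hd' : (0:ℝ) < d := hβ0.trans hβ1
  have hd : 0 < d := by exact_mod_cast hd'
  have hs : 0 < ((d : ℝ) - β) / α := div_pos (by linarith) hα0
  have hp : 0 < ((d : ℝ) - β) / 2 := by linarith
  have hΓs := Real.Gamma_pos_of_pos hs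
  have hΓp := Real.Gamma_pos_of_pos hp
  have h2pow : (2:ℝ) ^ (β / 2 + 1) * 2 ^ (-(β / 2) - 1) = 1 := by
    rw [← Real.rpow_add (by norm_num)]; simp
  constructor
  · intro x hx
    have hx' : 0 < ‖x‖ := norm_pos_iff.2 hx
    have hM := main_limit d hd (α / 2) (((d : ℝ) - β) / α) (((d : ℝ) - β) / 2)
      (by linarith) (by linarith) hs (by field_simp) x hx
    rw [mul_assoc _ (‖x‖ ^ (-(β / 2))), bessel_simp _ _ hx']
    set I := ∫ u in Ioi (0 : ℝ), u ^ (-(β / 2) - 1) * Real.exp (-u - ‖x‖ ^ 2 / (4 * u)) with hI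
    have hB : ∫ u in Ioi (0:ℝ), u ^ (((d : ℝ) - β) / 2 - 1) * (Real.exp (-u) *
        ((π / u) ^ ((d : ℝ) / 2) * Real.exp (-(‖x‖ ^ 2 / 4 / u)))) = π ^ ((d : ℝ) / 2) * I := by
      rw [hI, ← integral_const_mul]
      refine setIntegral_congr_fun measurableSet_Ioi fun u hu => ?_
      have hu : 0 < u := hu
      have e2 : Real.exp (-u - ‖x‖ ^ 2 / (4 * u)) =
          Real.exp (-u) * Real.exp (-(‖x‖ ^ 2 / 4 / u)) := by
        rw [← Real.exp_add]; congr 1; field_simp; ring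
      have e3 : u ^ (-(β / 2) - 1) = u ^ (((d : ℝ) - β) / 2 - 1) * (u ^ ((d : ℝ) / 2))⁻¹ := by
        rw [← Real.rpow_neg hu.le, ← Real.rpow_add hu]; congr 1; ring
      rw [e2, e3, Real.div_rpow Real.pi_pos.le hu.le]
      ring
    rw [hB] at hM
    have hA : hBeta d α β x = (2 * π) ^ (-(d : ℝ)) *
        ∫ t in Ioi (0:ℝ), t ^ (((d : ℝ) - β) / α - 1) *
        ∫ z : Ed d, Real.cos ⟪x, z⟫ * Real.exp (-(t * (‖z‖ ^ 2 + 1) ^ (α / 2))) := by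
      unfold hBeta hBetaM relKernel
      rw [← integral_const_mul]
      congr 1
      ext t
      have e1 : ((d : ℝ) - α - β) / α = ((d : ℝ) - β) / α - 1 := by field_simp; ring
      simp only [zero_sub, inner_neg_left, Real.cos_neg, Real.one_rpow, neg_mul, e1]
      ring
    have hpi : (2 * π) ^ (-(d : ℝ)) * π ^ ((d : ℝ) / 2) * (4 * π) ^ ((d : ℝ) / 2) = 1 := by
      have : (2 * π) ^ (d : ℝ) = π ^ ((d : ℝ) / 2) * (4 * π) ^ ((d : ℝ) / 2) := by
        rw [← Real.mul_rpow (by positivity) (by positivity),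
          show π * (4 * π) = (2 * π) ^ (2:ℝ) by rw [Real.rpow_two]; ring,
          ← Real.rpow_mul (by positivity)]
        congr 1; ring
      rw [Real.rpow_neg (by positivity), mul_assoc, ← this]
      exact inv_mul_cancel₀ (by positivity)
    rw [hA]
    set A := ∫ t in Ioi (0:ℝ), t ^ (((d : ℝ) - β) / α - 1) *
        ∫ z : Ed d, Real.cos ⟪x, z⟫ * Real.exp (-(t * (‖z‖ ^ 2 + 1) ^ (α / 2)))
    rw [div_mul_eq_mul_div, eq_div_iff (by positivity)]
    linear_combination ((2 * π) ^ (-(d : ℝ)) * (4 * π) ^ ((d : ℝ) / 2)) * hM +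
      (Real.Gamma (((d : ℝ) - β) / α) * I) * hpi -
      (Real.Gamma (((d : ℝ) - β) / α) * I) * h2pow
  · intro r₁ h1 r₂ h2 h12
    have h1 : 0 < r₁ := h1
    have h2 : 0 < r₂ := h2
    simp only
    rw [mul_assoc _ (r₁ ^ (-(β / 2))), mul_assoc _ (r₂ ^ (-(β / 2))), bessel_simp _ _ h1,
      bessel_simp _ _ h2]
    have := bessel_strictAnti (β / 2) (by linarith) r₁ r₂ h1 h12
    gcongr
end
end

section
/- Let d ∈ ℕ, α ∈ (0, min(2,d)) and β ∈ (0, d-α). Then lim_{x→0} V_β(x) / (κ_β |x|^{-α}) = 1, i.e. V_β(x) |x|^α / κ_β → 1 as |x| → 0 with x ≠ 0. -/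
open MeasureTheory Real Set Filter RealInnerProductSpace

noncomputable section

theorem bk_subst (ν r : ℝ) (hr : 0 < r) :
    besselK ν r = (1 / 2) * (r / 2) ^ (-ν) *
      ∫ v in Ioi (0 : ℝ), v ^ (ν - 1) * Real.exp (-v - r ^ 2 / (4 * v)) := by
  have hc : 0 < r ^ 2 / 4 := by positivity
  have h1 := integral_comp_rpow_Ioi
    (fun u : ℝ => u ^ (-ν - 1) * Real.exp (-u - r ^ 2 / (4 * u))) (p := -1) (by norm_num)
  have h2 := integral_comp_mul_left_Ioi
    (fun v : ℝ => v ^ (ν - 1) * Real.exp (-v - r ^ 2 / (4 * v))) 0 hc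
  rw [mul_zero] at h2
  have h3 : ∫ x in Ioi (0 : ℝ), (r ^ 2 / 4 * x) ^ (ν - 1) *
        Real.exp (-(r ^ 2 / 4 * x) - r ^ 2 / (4 * (r ^ 2 / 4 * x))) =
      (r ^ 2 / 4) ^ (ν - 1) * ∫ x in Ioi (0 : ℝ), (|(-1 : ℝ)| * x ^ ((-1 : ℝ) - 1)) •
        ((x ^ (-1 : ℝ)) ^ (-ν - 1) * Real.exp (-(x ^ (-1 : ℝ)) - r ^ 2 / (4 * x ^ (-1 : ℝ)))) := by
    rw [← integral_const_mul]
    refine setIntegral_congr_fun measurableSet_Ioi fun x hx => ?_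
    have hx : 0 < x := hx
    simp only [smul_eq_mul, abs_neg, abs_one, one_mul]
    rw [Real.mul_rpow hc.le hx.le, ← Real.rpow_mul hx.le, mul_assoc, ← mul_assoc (x ^ _) (x ^ _),
      ← Real.rpow_add hx, Real.rpow_neg_one]
    congr 3
    · ring
    · field_simp
      ring
  rw [h1] at h3
  rw [h2, smul_eq_mul] at h3
  unfold besselK
  set A := ∫ u in Ioi (0 : ℝ), u ^ (-ν - 1) * Real.exp (-u - r ^ 2 / (4 * u))
  set B := ∫ v in Ioi (0 : ℝ), v ^ (ν - 1) * Real.exp (-v - r ^ 2 / (4 * v))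
  have h4 : B = (r ^ 2 / 4) ^ ν * A := by
    rw [Real.rpow_sub_one hc.ne'] at h3
    field_simp at h3
    field_simp
    linarith
  have h5 : (r ^ 2 / 4) ^ ν = (r / 2) ^ ν * (r / 2) ^ ν := by
    rw [← Real.mul_rpow (by positivity) (by positivity)]
    congr 1; ring
  have h6 : (r / 2) ^ ν ≠ 0 := by positivity
  rw [h4, h5, Real.rpow_neg (by positivity)]
  field_simp

theorem bk_tendsto (ν : ℝ) (hν : 0 < ν) :
    Tendsto (fun r : ℝ => ∫ v in Ioi (0 : ℝ), v ^ (ν - 1) * Real.exp (-v - r ^ 2 / (4 * v)))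
      (nhds 0) (nhds (Real.Gamma ν)) := by
  rw [Real.Gamma_eq_integral hν]
  refine tendsto_integral_filter_of_dominated_convergence
    (fun x => Real.exp (-x) * x ^ (ν - 1)) ?_ ?_ (Real.GammaIntegral_convergent hν) ?_
  · refine Eventually.of_forall fun r => ?_
    exact Measurable.aestronglyMeasurable (by fun_prop)
  · refine Eventually.of_forall fun r => ?_
    filter_upwards [ae_restrict_mem measurableSet_Ioi] with x hx
    have hx : 0 < x := hx
    rw [Real.norm_of_nonneg (by positivity), mul_comm]
    gcongr
    have : 0 ≤ r ^ 2 / (4 * x) := by positivity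
    linarith
  · filter_upwards with x
    have : ContinuousAt (fun r : ℝ => x ^ (ν - 1) * Real.exp (-x - r ^ 2 / (4 * x))) 0 := by
      fun_prop
    have h := this.tendsto
    simpa [mul_comm] using h

/-- `V_β(x)/(κ_β |x|^{-α}) → 1` as `|x| → 0` (Lemma 2.7). -/
theorem stmt_7 (d : ℕ) (α β : ℝ) (hα : α ∈ Ioo 0 (min 2 (d : ℝ)))
    (hβ : β ∈ Ioo 0 ((d : ℝ) - α)) :
    Tendsto (fun x : Ed d => Vbeta d α β x * ‖x‖ ^ α / kappa d α β)
      (nhdsWithin (0 : Ed d) {(0 : Ed d)}ᶜ) (nhds 1) := by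
  obtain ⟨ha, _⟩ := hα
  obtain ⟨hb, hb2⟩ := hβ
  have g1 : 0 < Real.Gamma (((d : ℝ) - β) / 2) := Real.Gamma_pos_of_pos (by linarith)
  have g2 : 0 < Real.Gamma (((d : ℝ) - β - α) / 2) := Real.Gamma_pos_of_pos (by linarith)
  have g3 : 0 < Real.Gamma ((β + α) / 2) := Real.Gamma_pos_of_pos (by linarith)
  have g4 : 0 < Real.Gamma (β / 2) := Real.Gamma_pos_of_pos (by linarith)
  have t := (((bk_tendsto ((β + α) / 2) (by linarith)).div
    (bk_tendsto (β / 2) (by linarith)) g4.ne').mul_const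
      (Real.Gamma (β / 2) / Real.Gamma ((β + α) / 2)))
  have hn : Tendsto (fun x : Ed d => ‖x‖) (nhdsWithin (0 : Ed d) {(0 : Ed d)}ᶜ) (nhds 0) :=
    (tendsto_norm_zero).mono_left nhdsWithin_le_nhds
  have t2 := t.comp hn
  have e : Real.Gamma ((β + α) / 2) / Real.Gamma (β / 2) *
      (Real.Gamma (β / 2) / Real.Gamma ((β + α) / 2)) = 1 := by field_simp
  rw [e] at t2
  refine t2.congr' ?_
  filter_upwards [self_mem_nhdsWithin] with x hx
  have hr : 0 < ‖x‖ := norm_pos_iff.mpr hx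
  simp only [Function.comp, Pi.div_apply, Vbeta, VProf, kappa]
  rw [bk_subst _ _ hr, bk_subst _ _ hr]
  generalize ‖x‖ = r at hr
  generalize (∫ v in Ioi (0 : ℝ), v ^ ((β + α) / 2 - 1) * Real.exp (-v - r ^ 2 / (4 * v))) = A
  generalize (∫ v in Ioi (0 : ℝ), v ^ (β / 2 - 1) * Real.exp (-v - r ^ 2 / (4 * v))) = B
  have q1 : (r / 2) ^ (-((β + α) / 2)) = (r / 2) ^ (-(β / 2)) * (2 ^ (α / 2) / r ^ (α / 2)) := by
    rw [show -((β + α) / 2) = -(β / 2) + -(α / 2) by ring, Real.rpow_add (by positivity)]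
    congr 1
    rw [Real.rpow_neg (by positivity), Real.div_rpow hr.le (by norm_num), inv_div]
  have q2 : r ^ α = r ^ (α / 2) * r ^ (α / 2) := by
    rw [← Real.rpow_add hr]; congr 1; ring
  have q3 : (2 : ℝ) ^ α = 2 ^ (α / 2) * 2 ^ (α / 2) := by
    rw [← Real.rpow_add (by norm_num)]; congr 1; ring
  rw [q1, q2, q3, Real.rpow_neg hr.le]
  have p1 : 0 < r ^ (α / 2) := by positivity
  have p2 : (0 : ℝ) < 2 ^ (α / 2) := by positivity
  have p3 : 0 < (r / 2) ^ (-(β / 2)) := by positivity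
  generalize r ^ (α / 2) = X at *
  generalize (2 : ℝ) ^ (α / 2) = Y at *
  generalize (r / 2) ^ (-(β / 2)) = Z at *
  by_cases hB : B = 0
  · simp [hB]
  field_simp
end
end

section
/- Let d ∈ ℕ, α ∈ (0, min(2,d)) and β ∈ (0, d-α). Then for every x ∈ ℝ^d \ {0}, V_β(x) - κ_β |x|^{-α} > 0. -/
open MeasureTheory Real Set Filter RealInnerProductSpace

noncomputable section

/-- Integrability against the damped Gamma weight. -/
lemma aux_int {s c : ℝ} (hs : 0 < s) (hc : 0 < c) :
    IntegrableOn (fun w : ℝ => Real.exp (-w) * w ^ (s - 1) * Real.exp (-(c / w))) (Ioi 0) := by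
  have h := Real.GammaIntegral_convergent hs
  refine Integrable.mono' h ?_ ?_
  · refine Measurable.aestronglyMeasurable ?_
    fun_prop
  · refine (ae_restrict_iff' measurableSet_Ioi).2 (Eventually.of_forall fun w hw => ?_)
    have hw : 0 < w := hw
    rw [Real.norm_of_nonneg (by positivity)]
    have : Real.exp (-(c / w)) ≤ 1 := Real.exp_le_one_iff.2 (by
      have := div_pos hc hw
      linarith)
    exact mul_le_of_le_one_right (by positivity) this

/-- The strict Chebyshev-type inequality. -/
lemma aux_cheb {a b c : ℝ} (ha : 0 < a) (hb : 0 < b) (hc : 0 < c) :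
    Real.Gamma (b + a) * (∫ w in Ioi (0 : ℝ), Real.exp (-w) * w ^ (b - 1) * Real.exp (-(c / w))) <
      Real.Gamma b *
        ∫ w in Ioi (0 : ℝ), Real.exp (-w) * w ^ (b + a - 1) * Real.exp (-(c / w)) := by
  have hG := Real.Gamma_pos_of_pos hb
  have hGa := Real.Gamma_pos_of_pos (add_pos hb ha)
  set q := Real.Gamma (b + a) / Real.Gamma b with hq
  have hq0 : 0 < q := div_pos hGa hG
  set w0 := q ^ (1 / a) with hw0
  have hw0p : 0 < w0 := Real.rpow_pos_of_pos hq0 _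
  have hw0a : w0 ^ a = q := by
    rw [hw0, ← Real.rpow_mul hq0.le, one_div_mul_cancel ha.ne', Real.rpow_one]
  set k := Real.exp (-(c / w0)) with hk
  have i1 := aux_int (add_pos hb ha) hc
  have i2 := aux_int hb hc
  have i3 := Real.GammaIntegral_convergent (add_pos hb ha)
  have i4 := Real.GammaIntegral_convergent hb
  let F : ℝ → ℝ := fun w =>
    (Real.exp (-w) * w ^ (b + a - 1) * Real.exp (-(c / w))
      - q * (Real.exp (-w) * w ^ (b - 1) * Real.exp (-(c / w))))
    - (k * (Real.exp (-w) * w ^ (b + a - 1)) - k * q * (Real.exp (-w) * w ^ (b - 1)))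
  have iF1 := i1.sub (i2.const_mul q)
  have iF2 := (i3.const_mul k).sub (i4.const_mul (k * q))
  have iF : IntegrableOn F (Ioi 0) := iF1.sub iF2
  have hF : ∀ w, 0 < w → F w =
      Real.exp (-w) * w ^ (b - 1) * ((w ^ a - w0 ^ a) * (Real.exp (-(c / w)) - k)) := by
    intro w hw
    have : w ^ (b + a - 1) = w ^ (b - 1) * w ^ a := by
      rw [← Real.rpow_add hw]; ring_nf
    simp only [F, this, hw0a]
    ring
  have hpos : ∀ w, 0 < w → w ≠ w0 → 0 < F w := by
    intro w hw hne
    rw [hF w hw]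
    refine mul_pos (by positivity) ?_
    rcases lt_or_gt_of_ne hne with h | h
    · refine mul_pos_of_neg_of_neg (sub_neg.2 (Real.rpow_lt_rpow hw.le h ha)) (sub_neg.2 ?_)
      exact Real.exp_lt_exp.2 (neg_lt_neg (div_lt_div_of_pos_left hc hw h))
    · refine mul_pos (sub_pos.2 (Real.rpow_lt_rpow hw0p.le h ha)) (sub_pos.2 ?_)
      exact Real.exp_lt_exp.2 (neg_lt_neg (div_lt_div_of_pos_left hc hw0p h))
  have hnn : ∀ w, 0 < w → 0 ≤ F w := by
    intro w hw
    by_cases h : w = w0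
    · rw [hF w hw, h]; simp
    · exact (hpos w hw h).le
  have hI : 0 < ∫ w in Ioi (0 : ℝ), F w := by
    rw [setIntegral_pos_iff_support_of_nonneg_ae
      ((ae_restrict_iff' measurableSet_Ioi).2 (Eventually.of_forall fun w hw => hnn w hw)) iF]
    have hsub : Ioo 0 w0 ⊆ Function.support F ∩ Ioi 0 := fun w hw =>
      ⟨(hpos w hw.1 hw.2.ne).ne', hw.1⟩
    refine lt_of_lt_of_le ?_ (measure_mono hsub)
    rw [Real.volume_Ioo]
    simpa using hw0p
  have hE : ∫ w in Ioi (0 : ℝ), F w =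
      ((∫ w in Ioi (0 : ℝ), Real.exp (-w) * w ^ (b + a - 1) * Real.exp (-(c / w)))
      - q * (∫ w in Ioi (0 : ℝ), Real.exp (-w) * w ^ (b - 1) * Real.exp (-(c / w))))
      - (k * Real.Gamma (b + a) - k * q * Real.Gamma b) := by
    rw [Real.Gamma_eq_integral hb, Real.Gamma_eq_integral (add_pos hb ha),
      ← integral_const_mul, ← integral_const_mul, ← integral_const_mul,
      ← integral_sub i1 (i2.const_mul q), ← integral_sub (i3.const_mul k) (i4.const_mul (k * q))]
    exact integral_sub iF1 iF2
  have hqG : q * Real.Gamma b = Real.Gamma (b + a) := div_mul_cancel₀ _ hG.ne'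
  rw [hE, mul_assoc k, hqG, sub_self, sub_zero, sub_pos] at hI
  calc _ = Real.Gamma b * (q * _) := by rw [← hqG]; ring
    _ < _ := mul_lt_mul_of_pos_left hI hG

lemma aux_bessel {ν r : ℝ} (hr : 0 < r) :
    besselK ν r = (1 / 2) * (r / 2) ^ (-ν) *
      ∫ w in Ioi (0 : ℝ), Real.exp (-w) * w ^ (ν - 1) * Real.exp (-((r ^ 2 / 4) / w)) := by
  set c := r ^ 2 / 4 with hc
  have hcp : 0 < c := by positivity
  have h1 := integral_comp_rpow_Ioi
    (fun u : ℝ => u ^ (-ν - 1) * Real.exp (-u - r ^ 2 / (4 * u))) (p := -1) (by norm_num)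
  have h2 := integral_comp_mul_left_Ioi
    (fun w : ℝ => Real.exp (-w) * w ^ (ν - 1) * Real.exp (-(c / w))) 0 hcp
  have h3 : c ^ (ν - 1) * (∫ x in Ioi (0 : ℝ), (|(-1 : ℝ)| * x ^ ((-1 : ℝ) - 1)) •
      ((x ^ (-1 : ℝ)) ^ (-ν - 1) * Real.exp (-(x ^ (-1 : ℝ)) - r ^ 2 / (4 * x ^ (-1 : ℝ))))) =
      ∫ x in Ioi (0 : ℝ), Real.exp (-(c * x)) * (c * x) ^ (ν - 1) * Real.exp (-(c / (c * x))) := by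
    rw [← integral_const_mul]
    refine setIntegral_congr_fun measurableSet_Ioi fun x hx => ?_
    have hx : 0 < x := hx
    simp only [smul_eq_mul, abs_neg, abs_one, one_mul]
    rw [← Real.rpow_mul hx.le, Real.mul_rpow hcp.le hx.le, mul_comm (Real.exp (-(c * x))),
      mul_assoc (c ^ (ν - 1) * x ^ (ν - 1)), ← Real.exp_add, ← mul_assoc (x ^ ((-1 : ℝ) - 1)),
      ← Real.rpow_add hx, ← mul_assoc, Real.rpow_neg_one]
    congr 2
    · congr 1; ring
    · rw [hc]; field_simp; ring
  rw [h1] at h3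
  rw [mul_zero] at h2
  rw [h2, smul_eq_mul] at h3
  have hcν : c ^ (ν - 1) = (r / 2) ^ ν * (r / 2) ^ ν * c⁻¹ := by
    rw [Real.rpow_sub_one hcp.ne', ← Real.mul_rpow (by positivity) (by positivity),
      div_eq_mul_inv, hc]
    congr 2; ring
  rw [hcν] at h3
  unfold besselK
  rw [Real.rpow_neg (by positivity)]
  have hp : 0 < (r / 2) ^ ν := by positivity
  have hci : c⁻¹ ≠ 0 := by positivity
  have h4 := mul_left_cancel₀ hci ((by rw [← h3]; ring :
    c⁻¹ * (((r / 2) ^ ν * (r / 2) ^ ν) *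
      ∫ u in Ioi (0 : ℝ), u ^ (-ν - 1) * Real.exp (-u - r ^ 2 / (4 * u))) = _))
  rw [← h4]
  generalize (∫ u in Ioi (0 : ℝ), u ^ (-ν - 1) * Real.exp (-u - r ^ 2 / (4 * u))) = I
  field_simp

/-- `V_β` strictly dominates the fractional Hardy potential `κ_β|x|^{-α}` (Corollary 2.8). -/
theorem stmt_8 (d : ℕ) (α β : ℝ) (hα : α ∈ Ioo 0 (min 2 (d : ℝ)))
    (hβ : β ∈ Ioo 0 ((d : ℝ) - α)) (x : Ed d) (hx : x ≠ 0) :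
    0 < Vbeta d α β x - kappa d α β * ‖x‖ ^ (-α) := by
  obtain ⟨hα0, hα1⟩ := hα
  obtain ⟨hβ0, hβ1⟩ := hβ
  have hr : 0 < ‖x‖ := norm_pos_iff.2 hx
  unfold Vbeta VProf kappa
  set r := ‖x‖
  have ha : 0 < α / 2 := by linarith
  have hb : 0 < β / 2 := by linarith
  have hc : 0 < r ^ 2 / 4 := by positivity
  have key := aux_cheb ha hb hc
  rw [aux_bessel hr, aux_bessel hr, show (β + α) / 2 = β / 2 + α / 2 by ring]
  have hG := Real.Gamma_pos_of_pos hb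
  have hG1 : 0 < Real.Gamma (((d : ℝ) - β) / 2) := Real.Gamma_pos_of_pos (by linarith)
  have hG2 : 0 < Real.Gamma (((d : ℝ) - β - α) / 2) := Real.Gamma_pos_of_pos (by linarith)
  have hJ : 0 < ∫ w in Ioi (0 : ℝ), Real.exp (-w) * w ^ (β / 2 - 1) *
      Real.exp (-((r ^ 2 / 4) / w)) := by
    rw [setIntegral_pos_iff_support_of_nonneg_ae
      ((ae_restrict_iff' measurableSet_Ioi).2 (Eventually.of_forall fun w hw => ?_))
      (aux_int hb hc)]
    · have hsub : Ioo (0 : ℝ) 1 ⊆ Function.support (fun w : ℝ => Real.exp (-w) *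
          w ^ (β / 2 - 1) * Real.exp (-((r ^ 2 / 4) / w))) ∩ Ioi 0 := fun w hw => by
        have := hw.1
        exact ⟨ne_of_gt (by positivity), hw.1⟩
      refine lt_of_lt_of_le ?_ (measure_mono hsub)
      rw [Real.volume_Ioo]
      simp
    · have hw : 0 < w := hw
      simp only [Pi.zero_apply]
      positivity
  set J := ∫ w in Ioi (0 : ℝ), Real.exp (-w) * w ^ (β / 2 - 1) *
      Real.exp (-((r ^ 2 / 4) / w))
  set J' := ∫ w in Ioi (0 : ℝ), Real.exp (-w) * w ^ (β / 2 + α / 2 - 1) *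
      Real.exp (-((r ^ 2 / 4) / w))
  have e1 : (r / 2) ^ (-(β / 2 + α / 2)) =
      (r / 2) ^ (-(β / 2)) * (2 ^ (α / 2) * r ^ (-(α / 2))) := by
    rw [neg_add, Real.rpow_add (by positivity), Real.div_rpow hr.le (by norm_num) (-(α / 2)),
      Real.rpow_neg (by norm_num : (0 : ℝ) ≤ 2) (α / 2), div_inv_eq_mul, mul_comm (r ^ _)]
  have e2 : (2 : ℝ) ^ α = 2 ^ (α / 2) * 2 ^ (α / 2) := by
    rw [← Real.rpow_add (by norm_num)]; ring_nf
  have e3 : r ^ (-α) = r ^ (-(α / 2)) * r ^ (-(α / 2)) := by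
    rw [← Real.rpow_add hr]; ring_nf
  rw [e1, e2, e3]
  have hA : 0 < (r / 2) ^ (-(β / 2)) := by positivity
  have hB : 0 < (2 : ℝ) ^ (α / 2) := by positivity
  have hC : 0 < r ^ (-(α / 2)) := by positivity
  set A := (r / 2) ^ (-(β / 2))
  set B := (2 : ℝ) ^ (α / 2)
  set C := r ^ (-(α / 2))
  set G1 := Real.Gamma (((d : ℝ) - β) / 2)
  set G2 := Real.Gamma (((d : ℝ) - β - α) / 2)
  set Gb := Real.Gamma (β / 2)
  set Ga := Real.Gamma (β / 2 + α / 2)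
  have : B * G1 / G2 * (1 / 2 * (A * (B * C)) * J' / (1 / 2 * A * J)) * C
      - B * B * Ga * G1 / (Gb * G2) * (C * C)
      = B ^ 2 * C ^ 2 * G1 / (G2 * Gb * J) * (Gb * J' - Ga * J) := by
    field_simp
  rw [this]
  exact mul_pos (by positivity) (sub_pos.2 key)
end
end

section
/- Let d ∈ ℕ, α ∈ (0, min(2,d)) and β ∈ (0, d-α). The radial profile V_β(r) = (2^{α/2} Γ((d-β)/2) / Γ((d-β-α)/2)) · (K_{(β+α)/2}(r) / K_{β/2}(r)) · r^{-α/2} is differentiable on (0,∞) with V_β'(r) < 0 for every r > 0; in particular V_β(r) is strictly decreasing on (0,∞). -/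
open MeasureTheory Real Set Filter RealInnerProductSpace

noncomputable section

/-- The auxiliary integrand. -/
def auxJ (p s u : ℝ) : ℝ := u ^ p * Real.exp (-u - s / u)

lemma auxJ_contOn (p s : ℝ) : ContinuousOn (auxJ p s) (Ioi 0) := by
  unfold auxJ
  intro u hu
  have hu' : u ≠ 0 := ne_of_gt hu
  apply ContinuousAt.continuousWithinAt
  have h1 : ContinuousAt (fun u : ℝ => u ^ p) u := Real.continuousAt_rpow_const _ _ (Or.inl hu')
  have h2 : ContinuousAt (fun u : ℝ => Real.exp (-u - s / u)) u := by
    have : ContinuousAt (fun u : ℝ => s / u) u := continuousAt_const.div continuousAt_id hu'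
    exact (continuousAt_id.neg.sub this).rexp
  exact h1.mul h2

lemma auxJ_pos (p s : ℝ) {u : ℝ} (hu : 0 < u) : 0 < auxJ p s u := by
  unfold auxJ; positivity

lemma auxJ_meas (p s : ℝ) : AEStronglyMeasurable (auxJ p s) (volume.restrict (Ioi 0)) :=
  (auxJ_contOn p s).aestronglyMeasurable measurableSet_Ioi

lemma auxJ_int (p : ℝ) {s : ℝ} (hs : 0 < s) : IntegrableOn (auxJ p s) (Ioi 0) := by
  obtain ⟨N, hN⟩ := exists_nat_gt (-p)
  have hg := (Real.GammaIntegral_convergent (s := p + N + 1) (by linarith)).const_mul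
    ((N.factorial : ℝ) / s ^ N)
  refine Integrable.mono' hg (auxJ_meas p s) ?_
  refine (ae_restrict_mem measurableSet_Ioi).mono fun u hu => ?_
  have hu : 0 < u := hu
  rw [Real.norm_of_nonneg (auxJ_pos p s hu).le]
  unfold auxJ
  have h1 := Real.pow_div_factorial_le_exp (s / u) (by positivity) N
  have h2 : Real.exp (-(s / u)) ≤ (N.factorial : ℝ) / s ^ N * u ^ N := by
    rw [Real.exp_neg]
    have : (N.factorial : ℝ) / s ^ N * u ^ N = ((s / u) ^ N / N.factorial)⁻¹ := by
      rw [div_pow]; field_simp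
    rw [this]
    exact inv_anti₀ (by positivity) h1
  rw [show -u - s / u = -u + -(s / u) by ring, Real.exp_add]
  have h3 : u ^ (p + N + 1 - 1) = u ^ p * u ^ N := by
    rw [show p + N + 1 - 1 = p + N by ring, Real.rpow_add hu, Real.rpow_natCast]
  rw [h3]
  calc u ^ p * (Real.exp (-u) * Real.exp (-(s / u)))
      ≤ u ^ p * (Real.exp (-u) * ((N.factorial : ℝ) / s ^ N * u ^ N)) := by gcongr
    _ = _ := by ring

/-- The auxiliary integral. -/
def auxI (p s : ℝ) : ℝ := ∫ u in Ioi (0 : ℝ), auxJ p s u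

lemma auxI_pos (p : ℝ) {s : ℝ} (hs : 0 < s) : 0 < auxI p s := by
  unfold auxI
  rw [setIntegral_pos_iff_support_of_nonneg_ae
    ((ae_restrict_mem measurableSet_Ioi).mono fun u hu => (auxJ_pos p s hu).le) (auxJ_int p hs)]
  have : Function.support (auxJ p s) ∩ Ioi 0 = Ioi 0 :=
    inter_eq_right.mpr fun u hu => (auxJ_pos p s hu).ne'
  rw [this]; simp

lemma auxJ_mul (p q s : ℝ) {u : ℝ} (hu : 0 < u) : auxJ (p + q) s u = auxJ p s u * u ^ q := by
  unfold auxJ; rw [Real.rpow_add hu]; ring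

lemma auxI_hasDerivAt (p : ℝ) {s : ℝ} (hs : 0 < s) :
    HasDerivAt (auxI p) (-auxI (p - 1) s) s := by
  have h := hasDerivAt_integral_of_dominated_loc_of_deriv_le (μ := volume.restrict (Ioi (0:ℝ)))
    (F := fun s u => auxJ p s u) (F' := fun s u => -auxJ (p - 1) s u)
    (bound := auxJ (p - 1) (s / 2)) (x₀ := s) (s := Ioi (s / 2))
    (Ioi_mem_nhds (by linarith)) (Eventually.of_forall fun t => auxJ_meas p t)
    (auxJ_int p hs) (auxJ_meas _ _).neg ?_ (auxJ_int _ (by linarith)) ?_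
  · have h2 := h.2
    rw [integral_neg] at h2
    exact h2
  · refine (ae_restrict_mem measurableSet_Ioi).mono fun u hu t ht => ?_
    have hu : 0 < u := hu
    have ht : s / 2 < t := ht
    rw [norm_neg, Real.norm_of_nonneg (auxJ_pos _ _ hu).le]
    unfold auxJ
    gcongr
  · refine (ae_restrict_mem measurableSet_Ioi).mono fun u hu t ht => ?_
    have hu : 0 < u := hu
    have h1 : HasDerivAt (fun t : ℝ => -u - t / u) (-(1 / u)) t :=
      ((hasDerivAt_id t).div_const u).const_sub (-u)
    have h2 := h1.exp.const_mul (u ^ p)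
    refine h2.congr_deriv ?_
    unfold auxJ
    rw [Real.rpow_sub_one hu.ne']; ring

lemma auxI_cheb (p : ℝ) {a s : ℝ} (ha : 0 < a) (hs : 0 < s) :
    auxI (p - 1) s * auxI (p - a) s < auxI (p - a - 1) s * auxI p s := by
  have hP := auxI_pos p hs
  have hP1 := auxI_pos (p - 1) hs
  set m := auxI (p - 1) s / auxI p s with hm
  have hm0 : 0 < m := by positivity
  let G : ℝ → ℝ := fun u => auxJ (p - a - 1) s u - m * auxJ (p - a) s u
    - m ^ a * (auxJ (p - 1) s u - m * auxJ p s u)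
  have hG : ∀ u, 0 < u → G u = auxJ p s u * ((u⁻¹ - m) * (u⁻¹ ^ a - m ^ a)) := by
    intro u hu
    have e1 : auxJ (p - a) s u = auxJ p s u * u⁻¹ ^ a := by
      rw [sub_eq_add_neg, auxJ_mul p _ s hu, Real.rpow_neg hu.le, Real.inv_rpow hu.le]
    have e2 : auxJ (p - 1) s u = auxJ p s u * u⁻¹ := by
      rw [sub_eq_add_neg, auxJ_mul p _ s hu, Real.rpow_neg_one]
    have e3 : auxJ (p - a - 1) s u = auxJ p s u * u⁻¹ ^ a * u⁻¹ := by
      rw [sub_eq_add_neg, auxJ_mul _ _ s hu, Real.rpow_neg_one, e1]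
    simp only [G]; rw [e1, e2, e3]; ring
  have hpos : ∀ u, 0 < u → u ≠ m⁻¹ → 0 < G u := by
    intro u hu hne
    rw [hG u hu]
    refine mul_pos (auxJ_pos _ _ hu) ?_
    have hui : 0 < u⁻¹ := by positivity
    rcases lt_trichotomy u⁻¹ m with h | h | h
    · exact mul_pos_of_neg_of_neg (by linarith) (by linarith [Real.rpow_lt_rpow hui.le h ha])
    · exact absurd (by rw [← h, inv_inv]) hne
    · exact mul_pos (by linarith) (by linarith [Real.rpow_lt_rpow hm0.le h ha])
  have hnn : ∀ u, 0 < u → 0 ≤ G u := by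
    intro u hu
    by_cases h : u = m⁻¹
    · rw [hG u hu, h]; simp
    · exact (hpos u hu h).le
  have i1 := auxJ_int (p - a - 1) hs
  have i2 := (auxJ_int (p - a) hs).const_mul m
  have i3 := auxJ_int (p - 1) hs
  have i4 := (auxJ_int p hs).const_mul m
  have i5 := (i3.sub i4).const_mul (m ^ a)
  have hGi : IntegrableOn G (Ioi 0) := (i1.sub i2).sub i5
  have hGpos : 0 < ∫ u in Ioi (0 : ℝ), G u := by
    rw [setIntegral_pos_iff_support_of_nonneg_ae
      ((ae_restrict_mem measurableSet_Ioi).mono fun u hu => hnn u hu) hGi]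
    have hsub : Ioi m⁻¹ ⊆ Function.support G ∩ Ioi 0 := by
      intro u hu
      have hu : m⁻¹ < u := hu
      have hu0 : 0 < u := lt_trans (by positivity) hu
      exact ⟨(hpos u hu0 hu.ne').ne', hu0⟩
    refine lt_of_lt_of_le ?_ (measure_mono hsub)
    simp
  have hval : ∫ u in Ioi (0 : ℝ), G u = auxI (p - a - 1) s - m * auxI (p - a) s
      - m ^ a * (auxI (p - 1) s - m * auxI p s) := by
    simp only [G]
    have k1 := integral_sub (i1.sub i2) i5
    have k2 := integral_sub i1 i2
    have k3 := integral_sub i3 i4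
    simp only [Pi.sub_apply] at k1 k2 k3
    rw [k1, k2, integral_const_mul, integral_const_mul, k3, integral_const_mul]
    rfl
  have hz : auxI (p - 1) s - m * auxI p s = 0 := by rw [hm]; field_simp; ring
  rw [hval, hz] at hGpos
  have : m * auxI (p - a) s < auxI (p - a - 1) s := by linarith
  calc auxI (p - 1) s * auxI (p - a) s = m * auxI (p - a) s * auxI p s := by
        rw [hm]; field_simp
    _ < _ := by gcongr

lemma besselK_eq (ν r : ℝ) : besselK ν r = (1 / 2) * (r / 2) ^ ν * auxI (-ν - 1) (r ^ 2 / 4) := by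
  unfold besselK auxI auxJ
  simp only [div_div]

lemma VProf_eq (d : ℕ) (α β : ℝ) {r : ℝ} (hr : 0 < r) :
    VProf d α β r = Real.Gamma (((d : ℝ) - β) / 2) / Real.Gamma (((d : ℝ) - β - α) / 2) *
      (auxI (-(β / 2) - 1 - α / 2) (r ^ 2 / 4) / auxI (-(β / 2) - 1) (r ^ 2 / 4)) := by
  unfold VProf
  rw [besselK_eq, besselK_eq]
  have hr2 : 0 < r / 2 := by positivity
  have hI := auxI_pos (-(β / 2) - 1) (s := r ^ 2 / 4) (by positivity)
  rw [show (β + α) / 2 = β / 2 + α / 2 by ring, Real.rpow_add hr2,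
    show -(β / 2 + α / 2) - 1 = -(β / 2) - 1 - α / 2 by ring, Real.rpow_neg hr.le,
    Real.div_rpow hr.le (by norm_num) (α / 2)]
  have h1 : (2 : ℝ) ^ (α / 2) ≠ 0 := by positivity
  have h2 : r ^ (α / 2) ≠ 0 := by positivity
  have h3 : (r / 2) ^ (β / 2) ≠ 0 := by positivity
  generalize (2 : ℝ) ^ (α / 2) = A at *
  generalize r ^ (α / 2) = B at *
  generalize (r / 2) ^ (β / 2) = C at *
  field_simp

theorem stmt_9 (d : ℕ) (α β : ℝ) (hα : α ∈ Ioo 0 (min 2 (d : ℝ)))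
    (hβ : β ∈ Ioo 0 ((d : ℝ) - α)) :
    (∀ r : ℝ, 0 < r →
        DifferentiableAt ℝ (VProf d α β) r ∧ deriv (VProf d α β) r < 0) ∧
      StrictAntiOn (VProf d α β) (Ioi 0) := by
  obtain ⟨hα0, -⟩ := hα
  obtain ⟨hβ0, hβ1⟩ := hβ
  have key : ∀ r : ℝ, 0 < r → ∃ D, D < 0 ∧ HasDerivAt (VProf d α β) D r := by
    intro r hr
    have hs : 0 < r ^ 2 / 4 := by positivity
    have g1 := Real.Gamma_pos_of_pos (s := ((d : ℝ) - β) / 2) (by linarith)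
    have g2 := Real.Gamma_pos_of_pos (s := ((d : ℝ) - β - α) / 2) (by linarith)
    have hI := auxI_pos (-(β / 2) - 1) hs
    have hc := auxI_cheb (-(β / 2) - 1) (a := α / 2) (by linarith) hs
    have hsq : HasDerivAt (fun r : ℝ => r ^ 2 / 4) (r / 2) r := by
      have := (hasDerivAt_pow 2 r).div_const 4
      refine this.congr_deriv ?_
      push_cast; ring
    have hF := ((((auxI_hasDerivAt (-(β / 2) - 1 - α / 2) hs).div
      (auxI_hasDerivAt (-(β / 2) - 1) hs) hI.ne').comp r hsq).const_mul
      (Real.Gamma (((d : ℝ) - β) / 2) / Real.Gamma (((d : ℝ) - β - α) / 2)))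
    refine ⟨_, ?_, hF.congr_of_eventuallyEq ?_⟩
    · refine mul_neg_of_pos_of_neg (by positivity) (mul_neg_of_neg_of_pos ?_ (by positivity))
      refine div_neg_of_neg_of_pos ?_ (by positivity)
      linarith
    · filter_upwards [Ioi_mem_nhds hr] with t ht
      rw [VProf_eq d α β ht]; rfl
  have h1 : ∀ r : ℝ, 0 < r →
        DifferentiableAt ℝ (VProf d α β) r ∧ deriv (VProf d α β) r < 0 := by
    intro r hr
    obtain ⟨D, hD, h⟩ := key r hr
    exact ⟨h.differentiableAt, by rw [h.deriv]; exact hD⟩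
  refine ⟨h1, strictAntiOn_of_deriv_neg (convex_Ioi 0) ?_ ?_⟩
  · intro r hr
    exact (h1 r hr).1.continuousAt.continuousWithinAt
  · intro r hr
    rw [interior_Ioi] at hr
    exact (h1 r hr).2
end
end
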